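/- arXiv:1503.07056 — 8 statements merged into one kernel-verified Lean document; each statement's English description precedes it below -/
import Mathlib

section
/- Let q be a power of 2 and let a ∈ F_q with a ≠ 0 and F_2(a) = F_q (a generates F_q over the prime field). Then the subgroup of GL_6(F_q) generated by x and y equals the full symplectic group of J, i.e. an invertible 6×6 matrix g over F_q satisfies gᵀ J g = J if and only if g lies in the subgroup generated by x and y. In particular Sp_6(q) is (2,3)-generated for all even q. -/
open Matrix

section PowSubOne

open Polynomial

variable {F : Type*} [Field F] [Finite F] [CharP F 2]

theorem exists_odd_dvd_X_pow_sub_one {r : F[X]} (hr : r.Separable) (hm : r.Monic)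
    (h0 : r.coeff 0 ≠ 0) : ∃ n, Odd n ∧ r ∣ X ^ n - 1 := by
  have : Module.Finite F (AdjoinRoot r) := hm.finite_adjoinRoot
  have : Finite (AdjoinRoot r) := Module.finite_of_finite F
  have hu : IsUnit (AdjoinRoot.root r) := by
    have h : r = X * divX r + C (r.coeff 0) := (X_mul_divX_add r).symm
    have h1 := congrArg (AdjoinRoot.mk r) h
    rw [AdjoinRoot.mk_self, map_add, map_mul, AdjoinRoot.mk_X, AdjoinRoot.mk_C] at h1
    have h2 : IsUnit (AdjoinRoot.of r (r.coeff 0)) := (isUnit_iff_ne_zero.2 h0).map _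
    refine isUnit_of_mul_isUnit_left (y := AdjoinRoot.mk r (divX r)) ?_
    rw [← neg_eq_of_add_eq_zero_left h1.symm]
    exact h2.neg
  obtain ⟨u, hu⟩ := hu
  obtain ⟨k, n, hn, hk⟩ := Nat.exists_eq_two_pow_mul_odd (orderOf_pos u).ne'
  refine ⟨n, hn, (hr.squarefree.dvd_pow_iff_dvd (pow_ne_zero k two_ne_zero)).1 ?_⟩
  have : Fact (Nat.Prime 2) := ⟨Nat.prime_two⟩
  rw [sub_pow_char_pow, one_pow, ← pow_mul, mul_comm n, ← hk, ← AdjoinRoot.mk_eq_zero, map_sub,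
    map_pow, map_one, AdjoinRoot.mk_X, ← hu, ← Units.val_pow_eq_pow_val, pow_orderOf_eq_one,
    Units.val_one, sub_self]

end PowSubOne

theorem pow_mul_eq_mul_pow_of_involutive {M : Type*} [Monoid M] {a b : M} (ha : a * a = 1)
    (hb : b * b = 1) {m : ℕ} (h : (a * b) ^ (2 * m + 1) = 1) :
    (a * b) ^ (m + 1) * b = a * (a * b) ^ (m + 1) := by
  have hs : SemiconjBy a (a * b) (b * a) := by
    simp [SemiconjBy, ← mul_assoc, ha]; simp [mul_assoc, ha]
  have hba : (b * a) * (a * b) = 1 := by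
    rw [mul_assoc, ← mul_assoc a, ha, one_mul, hb]
  have hab : (a * b) * (b * a) = 1 := by
    rw [mul_assoc, ← mul_assoc b, hb, one_mul, ha]
  have hc : Commute (b * a) (a * b) := by rw [Commute, SemiconjBy, hab, hba]
  have hinv (k : ℕ) : (b * a) ^ k * (a * b) ^ k = 1 := by
    rw [← hc.mul_pow, hba, one_pow]
  have key : (a * b) ^ (2 * m) = b * a := by
    calc (a * b) ^ (2 * m) = (a * b) ^ (2 * m) * ((a * b) * (b * a)) := by rw [hab, mul_one]
      _ = b * a := by rw [← mul_assoc, ← pow_succ, h, one_mul]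
  calc (a * b) ^ (m + 1) * b = (a * b) ^ m * a := by
        rw [pow_succ, mul_assoc, mul_assoc a, hb, mul_one]
    _ = (b * a) ^ m * ((a * b) ^ (2 * m) * a) := by
        rw [two_mul, pow_add, mul_assoc, ← mul_assoc (_ ^ m), hinv, one_mul]
    _ = (b * a) ^ (m + 1) * a := by rw [key, mul_assoc b, ha, mul_one, pow_succ, mul_assoc,
        mul_assoc, ha, mul_one]
    _ = a * (a * b) ^ (m + 1) := ((hs.pow_right (m + 1)).eq).symm

section Transvection

open Polynomial LinearMap

variable {F V : Type*} [Field F] [CharP F 2] [AddCommGroup V] [Module F V]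

theorem LinearMap.BilinForm.IsAlt.apply_comm {B : LinearMap.BilinForm F V} (hB : B.IsAlt)
    (u v : V) :
    B u v = B v u := by
  rw [← hB.neg_eq, CharTwo.neg_eq]

theorem transvection_mul_self_of_isAlt {B : LinearMap.BilinForm F V} (hB : B.IsAlt) (v : V) :
    transvection (B v) v * transvection (B v) v = 1 := by
  ext z
  have h2 : (2 : F) = 0 := CharTwo.two_eq_zero
  simp only [Module.End.mul_apply, transvection.apply, map_add, map_smul, hB v,
    Module.End.one_apply]
  linear_combination (norm := module) (B v z * h2) • v

/-- `S` contains `0`, and the transvections `z ↦ z + B v z • v` with `v ∈ S` preserve `S`. On each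
line, `S` is closed under addition. -/
structure IsTransvectionClosed (B : LinearMap.BilinForm F V) (S : Set V) : Prop where
  zero_mem : 0 ∈ S
  transvection_mem : ∀ {u v}, u ∈ S → v ∈ S → transvection (B u) u v ∈ S
  add_smul_mem : ∀ {u} {c d : F}, c • u ∈ S → d • u ∈ S → (c + d) • u ∈ S

variable [Finite F]

theorem exists_odd_transvection_pow_eq_one {B : LinearMap.BilinForm F V} (hB : B.IsAlt) {u v : V}
    (huv : B u v ≠ 0) :
    ∃ n, Odd n ∧ (transvection (B u) u * transvection (B v) v) ^ n = 1 := by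
  have h2 : (2 : F) = 0 := CharTwo.two_eq_zero
  set β := B u v with hβ
  set D := transvection (B u) u * transvection (B v) v with hD
  let q : F[X] := X ^ 2 + C (β ^ 2) * X + 1
  have hC2 : (2 : F[X]) = 0 := by rw [← C_ofNat, h2, C_0]
  have hCβ : C (β ^ 2)⁻¹ * C (β ^ 2) = (1 : F[X]) := by
    rw [← C_mul, inv_mul_cancel₀ (pow_ne_zero 2 huv), C_1]
  have hq : q.Separable := by
    refine ⟨0, C (β ^ 2)⁻¹, ?_⟩
    simp only [q, derivative_add, derivative_mul, derivative_X_pow, derivative_C, derivative_X,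
      derivative_one]
    simp only [Nat.cast_ofNat, C_ofNat]
    linear_combination hCβ + C (β ^ 2)⁻¹ * X * hC2
  have hX1 : IsCoprime (X - 1 : F[X]) q := by
    refine ⟨C (β ^ 2)⁻¹ * (-(X + 1) - C (β ^ 2)), C (β ^ 2)⁻¹, ?_⟩
    linear_combination hCβ + C (β ^ 2)⁻¹ * hC2
  have hm : ((X - 1) * q).Monic := by
    have h1 : (X - 1 : F[X]).Monic := by simpa using monic_X_sub_C (1 : F)
    refine h1.mul ?_
    simp only [q]
    monicity!
  have hX : (X - 1 : F[X]).Separable := by simpa using separable_X_sub_C (x := (1 : F))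
  obtain ⟨n, hn, s, hs⟩ := exists_odd_dvd_X_pow_sub_one (F := F)
    (hX.mul hq hX1) hm
    (by simp [q, coeff_zero_eq_eval_zero])
  refine ⟨n, hn, ?_⟩
  have hvu : B v u = β := hB.apply_comm v u
  have hDu : D u = (1 + β ^ 2) • u + β • v := by
    simp only [hD, Module.End.mul_apply, transvection.apply, map_add, map_smul, hB u, hvu, ← hβ]
    module
  have hDv : D v = β • u + v := by
    simp only [hD, Module.End.mul_apply, transvection.apply, map_add, map_smul, hB v, ← hβ]
    module
  have hz : aeval D ((X - 1) * q) = 0 := by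
    ext z
    have hDz : D z = z + (B v z • v + (B u z + B v z * β) • u) := by
      simp only [hD, Module.End.mul_apply, transvection.apply, map_add, map_smul, ← hβ]
      module
    rw [mul_comm]
    simp only [q, map_mul, map_add, map_sub, aeval_X, map_one, aeval_C, pow_two,
      Module.End.mul_apply, LinearMap.sub_apply, LinearMap.add_apply, Module.End.one_apply,
      Module.algebraMap_end_apply, hDz, map_smul, hDu, hDv, LinearMap.zero_apply,
      add_sub_cancel_left]
    generalize B v z = c
    generalize B u z = d
    linear_combination (norm := module)
      ((c * β + (d + c * β) * (β ^ 2 + 1) + β ^ 2 * (c * β + (d + c * β) * (1 + β ^ 2))) * h2) • u +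
        ((c + c * β ^ 2 + (d + c * β) * (β + β ^ 3)) * h2) • v
  have := congrArg (aeval D) hs
  rwa [map_mul, hz, zero_mul, map_sub, map_pow, aeval_X, map_one, sub_eq_zero] at this

end Transvection

section TransvectionClosed

open Polynomial LinearMap

variable {F V : Type*} [Field F] [CharP F 2] [AddCommGroup V] [Module F V]

theorem transvection_isometry {B : LinearMap.BilinForm F V} (hB : B.IsAlt) (v x y : V) :
    B (transvection (B v) v x) (transvection (B v) v y) = B x y := by
  simp only [transvection.apply, map_add, map_smul, LinearMap.add_apply, LinearMap.smul_apply,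
    smul_eq_mul, hB v, hB.apply_comm x v]
  linear_combination B v x * B v y * CharTwo.two_eq_zero (R := F)

theorem IsTransvectionClosed.exists_map_eq [Finite F] {B : LinearMap.BilinForm F V} (hB : B.IsAlt)
    {S : Set V} (hS : IsTransvectionClosed B S) {u w : V} (hu : u ∈ S) (hw : w ∈ S)
    (huw : B u w ≠ 0) : ∃ k : Module.End F V, (∀ s ∈ S, k s ∈ S) ∧ k u = w := by
  have hwu : B w u ≠ 0 := by rwa [hB.apply_comm]
  obtain ⟨n, ⟨m, rfl⟩, hm⟩ := exists_odd_transvection_pow_eq_one hB hwu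
  have hk := pow_mul_eq_mul_pow_of_involutive (transvection_mul_self_of_isAlt hB w)
    (transvection_mul_self_of_isAlt hB u) hm
  have hpow (j : ℕ) : (∀ s ∈ S, ((transvection (B w) w * transvection (B u) u) ^ j) s ∈ S) ∧
      ∀ x y, B (((transvection (B w) w * transvection (B u) u) ^ j) x)
        (((transvection (B w) w * transvection (B u) u) ^ j) y) = B x y := by
    induction j with
    | zero => simp
    | succ j ih =>
      simp only [pow_succ', Module.End.mul_apply, transvection_isometry hB]
      exact ⟨fun s hs => hS.transvection_mem hw (hS.transvection_mem hu (ih.1 s hs)), ih.2⟩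
  obtain ⟨hkS, hkB⟩ := hpow (m + 1)
  set k := (transvection (B w) w * transvection (B u) u) ^ (m + 1)
  have hw0 : w ≠ 0 := by rintro rfl; simp at huw
  have h1 (z : V) : B u z • k u = B w (k z) • w := by
    have := congrArg (fun f : Module.End F V => f z) hk
    simpa only [Module.End.mul_apply, transvection.apply, map_add, map_smul,
      add_right_inj] using this
  obtain ⟨μ, hμ⟩ : ∃ μ : F, k u = μ • w := by
    refine ⟨(B u w)⁻¹ * B w (k w), ?_⟩
    rw [mul_smul, ← h1, inv_smul_smul₀ huw]
  have h2 : μ * B u w = B w (k w) := by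
    have := h1 w
    rw [hμ, smul_smul] at this
    rw [mul_comm]
    exact smul_left_injective F hw0 this
  have h3 : μ * B w (k w) = B u w := by
    rw [← hkB u w, hμ, map_smul, LinearMap.smul_apply, smul_eq_mul]
  have h4 : (μ - 1) ^ 2 = 0 := by
    refine (mul_eq_zero.1 (?_ : (μ - 1) ^ 2 * B u w = 0)).resolve_right huw
    linear_combination μ * h2 + h3 + (1 - μ) * B u w * CharTwo.two_eq_zero (R := F)
  refine ⟨k, hkS, ?_⟩
  rw [hμ, sub_eq_zero.1 (pow_eq_zero_iff two_ne_zero |>.1 h4), one_smul]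

theorem IsTransvectionClosed.smul_mem_of_mem_closure [Finite F] {B : LinearMap.BilinForm F V}
    (hB : B.IsAlt) {S : Set V} (hS : IsTransvectionClosed B S) {u w : V} (hu : u ∈ S) (hw : w ∈ S)
    (huw : B u w ≠ 0) {T : Set F} (hT : ∀ c ∈ T, c • u ∈ S) {c : F} (hc : c ∈ Subfield.closure T) :
    c • u ∈ S := by
  have := Fintype.ofFinite F
  have hmul {c d : F} (hc : c • u ∈ S) (hd : d • u ∈ S) : (c * d) • u ∈ S := by
    rcases eq_or_ne c 0 with rfl | hc0
    · simpa using hc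
    obtain ⟨k₁, hk₁, h₁⟩ := hS.exists_map_eq hB hu hw huw
    obtain ⟨k₂, hk₂, h₂⟩ := hS.exists_map_eq hB hw hc (by
      rw [map_smul, smul_eq_mul, hB.apply_comm]; exact mul_ne_zero hc0 huw)
    have := hk₂ _ (hk₁ _ hd)
    rwa [map_smul, map_smul, h₁, h₂, smul_smul, mul_comm] at this
  have hone : (1 : F) • u ∈ S := by rwa [one_smul]
  have hpow {c : F} (hc : c • u ∈ S) (n : ℕ) : c ^ n • u ∈ S := by
    induction n with
    | zero => rwa [pow_zero]
    | succ n ih => rw [pow_succ]; exact hmul ih hc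
  let L : Subfield F :=
    { carrier := {c | c • u ∈ S}
      mul_mem' := hmul
      one_mem' := hone
      add_mem' := hS.add_smul_mem
      zero_mem' := by simpa using hS.zero_mem
      neg_mem' := fun {c} hc => by rwa [CharTwo.neg_eq]
      inv_mem' := fun c hc => by
        rcases eq_or_ne c 0 with rfl | hc0
        · rwa [_root_.inv_zero]
        have h : c⁻¹ = c ^ (Fintype.card F - 2) := by
          refine inv_eq_of_mul_eq_one_right ?_
          have := Fintype.one_lt_card (α := F)
          rw [← pow_succ', ← FiniteField.pow_card_sub_one_eq_one c hc0]
          congr 1; omega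
        rw [h]
        exact hpow hc _ }
  exact (Subfield.closure_le (t := L)).2 hT hc

section Scalars

variable {B : LinearMap.BilinForm F V} {P : Set V}

theorem smul_add_smul_add_mem (hB : B.IsAlt) (hsmul : ∀ (c : F), ∀ x ∈ P, c • x ∈ P)
    (hadd : ∀ x ∈ P, ∀ y ∈ P, B x y ≠ 0 → x + y ∈ P) {p p' : V} (hp : p ∈ P) (hp' : p' ∈ P)
    (hpp' : B p p' ≠ 0) {z : V} (hz : B p z = 0) (hz' : B p' z = 0) {α γ α' γ' : F}
    (h : α ≠ 0 ∨ γ ≠ 0) (h' : α' ≠ 0 ∨ γ' ≠ 0) (hmem : α • p + γ • p' + z ∈ P) :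
    α' • p + γ' • p' + z ∈ P := by
  have hmove {x : V} (hx : x ∈ P) {y : V} (hy : y ∈ P) (hxy : B y x ≠ 0) (c : F) :
      c • y + x ∈ P := by
    rcases eq_or_ne c 0 with rfl | hc
    · simpa using hx
    · exact hadd _ (hsmul c y hy) _ hx (by simpa using ⟨hc, hxy⟩)
  have hl {α γ : F} (α' : F) (hγ : γ ≠ 0) (hmem : α • p + γ • p' + z ∈ P) :
      α' • p + γ • p' + z ∈ P := by
    convert hmove hmem hp (by simpa [hB p, hz] using ⟨hγ, hpp'⟩) (α' - α) using 1
    module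
  have hr {α γ : F} (γ' : F) (hα : α ≠ 0) (hmem : α • p + γ • p' + z ∈ P) :
      α • p + γ' • p' + z ∈ P := by
    convert hmove hmem hp' (by simpa [hB p', hz', hB.apply_comm p' p] using ⟨hα, hpp'⟩)
      (γ' - γ) using 1
    module
  have h11 : (1 : F) • p + (1 : F) • p' + z ∈ P := by
    rcases h with h | h
    · exact hl 1 one_ne_zero (hr 1 h hmem)
    · exact hr 1 one_ne_zero (hl 1 h hmem)
  rcases h' with h' | h'
  · exact hr γ' h' (hl α' one_ne_zero h11)
  · exact hl α' h' (hr γ' one_ne_zero h11)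

theorem forall_mem_of_span_eq_top (hB : B.IsAlt) (hB' : B.Nondegenerate)
    (hF : ∃ c : F, c ≠ 0 ∧ c ≠ 1) (hsmul : ∀ (c : F), ∀ x ∈ P, c • x ∈ P)
    (hadd : ∀ x ∈ P, ∀ y ∈ P, B x y ≠ 0 → x + y ∈ P) {p p' : V} (hp : p ∈ P) (hp' : p' ∈ P)
    (hpp' : B p p' ≠ 0) {E : Set V} (hE : ∀ e ∈ E, e ∈ P ∧ B p e ≠ 0)
    (hspan : Submodule.span F (insert p E) = ⊤) (x : V) : x ∈ P := by
  have hmove := @smul_add_smul_add_mem F V _ _ _ _ B P hB hsmul hadd p p' hp hp' hpp'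
  obtain ⟨c, hc0, hc1⟩ := hF
  have h1 {z : V} (hz : B p z = 0) (hz' : B p' z = 0) {α γ : F} (h : α ≠ 0 ∨ γ ≠ 0)
      (hmem : α • p + γ • p' + z ∈ P) : p + z ∈ P := by
    simpa using hmove hz hz' h (Or.inl one_ne_zero) (α' := 1) (γ' := 0) hmem
  have h2 {z : V} (hz : B p z = 0) (hz' : B p' z = 0) (hmem : p + z ∈ P) {α γ : F}
      (h : α ≠ 0 ∨ γ ≠ 0) : α • p + γ • p' + z ∈ P :=
    hmove hz hz' (Or.inl one_ne_zero) h (α := 1) (γ := 0) (by simpa using hmem)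
  let Z : Submodule F V :=
    { carrier := {z | B p z = 0 ∧ B p' z = 0 ∧ p + z ∈ P}
      zero_mem' := ⟨map_zero _, map_zero _, by simpa using hp⟩
      smul_mem' := fun d z ⟨hz, hz', hm⟩ => by
        have hdz : B p (d • z) = 0 := by simp [hz]
        have hdz' : B p' (d • z) = 0 := by simp [hz']
        refine ⟨hdz, hdz', ?_⟩
        rcases eq_or_ne d 0 with rfl | hd
        · simpa using hp
        · exact h1 hdz hdz' (Or.inl hd) (γ := 0) (by simpa using hsmul d _ hm)
      add_mem' := fun {z y} ⟨hz, hz', hzm⟩ ⟨hy, hy', hym⟩ => by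
        have hzy : B p (z + y) = 0 := by simp [hz, hy]
        have hzy' : B p' (z + y) = 0 := by simp [hz', hy']
        refine ⟨hzy, hzy', ?_⟩
        by_cases h : B z y = 0
        · refine h1 hzy hzy' (Or.inl one_ne_zero) (γ := 1) ?_
          convert hadd _ hzm _ (h2 hy hy' hym (α := 0) (γ := 1) (Or.inr one_ne_zero)) ?_ using 1
          · module
          · simpa [h, hB.apply_comm z p', hz', hy] using hpp'
        · refine h1 hzy hzy' (Or.inl (sub_ne_zero.2 hc1)) (γ := 0) ?_
          convert hadd _ (h2 hz hz' hzm (α := c) (γ := 0) (Or.inl hc0)) _ hym ?_ using 1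
          · rw [CharTwo.sub_eq_add]; module
          · simpa [hB p, hB.apply_comm z p, hz, hy] using h }
  have hdecomp (x : V) : ∃ α γ : F, ∃ z, B p z = 0 ∧ B p' z = 0 ∧ x = α • p + γ • p' + z ∧
      B p x = γ * B p p' ∧ B p' x = α * B p p' := by
    refine ⟨(B p p')⁻¹ * B p' x, (B p p')⁻¹ * B p x,
      x - ((B p p')⁻¹ * B p' x) • p - ((B p p')⁻¹ * B p x) • p', ?_, ?_, by module, ?_, ?_⟩
    · simp [hB p]; field_simp; ring
    · simp [hB p', hB.apply_comm p' p]; field_simp; ring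
    · field_simp
    · field_simp
  have hpmem : p ∈ Submodule.span F {p, p'} := Submodule.subset_span (by simp)
  have hpmem' : p' ∈ Submodule.span F {p, p'} := Submodule.subset_span (by simp)
  have htop : Submodule.span F {p, p'} ⊔ Z = ⊤ := by
    rw [eq_top_iff, ← hspan, Submodule.span_le]
    rintro x (rfl | hx)
    · exact Submodule.mem_sup_left hpmem
    · obtain ⟨hxP, hpx⟩ := hE x hx
      obtain ⟨α, γ, z, hz, hz', rfl, hγ, -⟩ := hdecomp x
      refine Submodule.add_mem_sup (add_mem (Submodule.smul_mem _ _ hpmem)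
        (Submodule.smul_mem _ _ hpmem')) ⟨hz, hz', h1 hz hz' (Or.inr ?_) hxP⟩
      rintro rfl
      exact hpx (by simpa using hγ)
  have key {x : V} (hx : B p x ≠ 0 ∨ B p' x ≠ 0) : x ∈ P := by
    obtain ⟨s, hs, z, ⟨hz, hz', hm⟩, rfl⟩ := Submodule.mem_sup.1 (htop ▸ Submodule.mem_top (x := x))
    obtain ⟨α, γ, rfl⟩ := Submodule.mem_span_pair.1 hs
    refine h2 hz hz' hm ?_
    contrapose! hx
    simp [hx, hz, hz']
  by_cases hx : B p x ≠ 0 ∨ B p' x ≠ 0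
  · exact key hx
  push Not at hx
  rcases eq_or_ne x 0 with rfl | hx0
  · simpa using hsmul 0 p hp
  obtain ⟨y, hy⟩ : ∃ y, B y x ≠ 0 := by
    by_contra! h
    exact hx0 (hB'.2 x h)
  obtain ⟨y', hy', hpy'⟩ : ∃ y', B y' x ≠ 0 ∧ B p' y' ≠ 0 := by
    by_cases h : B p' y = 0
    · exact ⟨y + p, by simpa [hx.1] using hy, by simpa [h, hB.apply_comm p' p] using hpp'⟩
    · exact ⟨y, hy, h⟩
  have := hadd y' (key (Or.inr hpy')) (y' + x) (key (Or.inr (by simpa [hx.2] using hpy')))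
    (by simpa [hB y'] using hy')
  convert this using 1
  linear_combination (norm := module) -(CharTwo.two_eq_zero (R := F)) • y'

end Scalars

theorem IsTransvectionClosed.eq_univ_of_span_eq_top [Finite F] {B : LinearMap.BilinForm F V}
    (hB : B.IsAlt) (hB' : B.Nondegenerate) {S : Set V} (hS : IsTransvectionClosed B S)
    (hF : ∃ c : F, c ≠ 0 ∧ c ≠ 1) {p p' : V} (hp : ∀ c : F, c • p ∈ S) (hp' : ∀ c : F, c • p' ∈ S)
    (hpp' : B p p' ≠ 0) {E : Set V} (hE : ∀ e ∈ E, (∀ c : F, c • e ∈ S) ∧ B p e ≠ 0)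
    (hspan : Submodule.span F (insert p E) = ⊤) (x : V) : x ∈ S := by
  suffices h : x ∈ {x | ∀ c : F, c • x ∈ S} by simpa using h 1
  refine forall_mem_of_span_eq_top (P := {x | ∀ c : F, c • x ∈ S}) hB hB' hF
    (fun c x hx d => ?_) (fun x hx y hy hxy d => ?_)
    hp hp' hpp' hE hspan x
  · rw [smul_smul]; exact hx _
  · obtain ⟨c, hc⟩ := isSquare_of_charTwo' (B x y)⁻¹
    have := hS.transvection_mem (hx c) (hy d)
    simp only [transvection.apply, map_smul, LinearMap.smul_apply, smul_eq_mul, smul_smul] at this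
    convert this using 1
    have h : c * c * B x y = 1 := by rw [← hc, inv_mul_cancel₀ hxy]
    linear_combination (norm := module) -(d * h) • x

end TransvectionClosed

section Generation

open LinearMap

variable {F V : Type*} [Field F] [CharP F 2] [AddCommGroup V] [Module F V]

theorem exists_map_eq_of_transvection_mem [Finite F] {B : LinearMap.BilinForm F V} (hB : B.IsAlt)
    {G : Subgroup (V ≃ₗ[F] V)} (hG : ∀ v, ∃ g ∈ G, ∀ z, g z = z + B v z • v) {x y : V}
    (hxy : B x y ≠ 0) : ∃ h ∈ G, h x = y ∧ ∀ z, B (x + y) z = 0 → h z = z := by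
  obtain ⟨c, hc⟩ := isSquare_of_charTwo' (B x y)⁻¹
  obtain ⟨g, hg, hgz⟩ := hG (c • (x + y))
  have h : c * c * B x y = 1 := by rw [← hc, inv_mul_cancel₀ hxy]
  refine ⟨g, hg, ?_, fun z hz => ?_⟩
  · rw [hgz]
    simp only [map_smul, map_add, LinearMap.smul_apply, LinearMap.add_apply, hB x,
      hB.apply_comm y x, smul_eq_mul]
    linear_combination (norm := module) h • (x + y) + CharTwo.two_eq_zero (R := F) • x
  · rw [hgz, map_smul, LinearMap.smul_apply, hz, smul_zero, zero_smul, add_zero]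

theorem mem_of_transvection_mem [Finite F] [FiniteDimensional F V]
    {B : LinearMap.BilinForm F V} (hB : B.IsAlt) (hB' : B.Nondegenerate)
    {G : Subgroup (V ≃ₗ[F] V)} (hG : ∀ v, ∃ g ∈ G, ∀ z, g z = z + B v z • v)
    (hGB : ∀ g ∈ G, ∀ x y, B (g x) (g y) = B x y) {g : V ≃ₗ[F] V}
    (hg : ∀ x y, B (g x) (g y) = B x y) : g ∈ G := by
  let b := Module.finBasis F V
  have key (k : ℕ) : k ≤ Module.finrank F V → ∃ h ∈ G, ∀ i, i.val < k → h (g (b i)) = b i := by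
    induction k with
    | zero => exact fun _ => ⟨1, one_mem _, by simp⟩
    | succ k ih =>
      intro hk
      obtain ⟨h, hh, hfix⟩ := ih (by omega)
      let j : Fin (Module.finrank F V) := ⟨k, hk⟩
      set w := b j
      have hiso (x y : V) : B (h (g x)) (h (g y)) = B x y := by rw [hGB h hh, hg]
      set x := h (g w)
      have hx {i} (hi : i.val < k) : B x (b i) = B w (b i) := by
        rw [← hiso w, hfix i hi]
      suffices hs : ∃ h' ∈ G, h' x = w ∧ ∀ i, i.val < k → h' (b i) = b i by
        obtain ⟨h', hh', hxw, hfix'⟩ := hs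
        refine ⟨h' * h, mul_mem hh' hh, fun i hi => ?_⟩
        rw [LinearEquiv.mul_apply]
        rcases Nat.lt_succ_iff_lt_or_eq.1 hi with hi | hi
        · rw [hfix i hi, hfix' i hi]
        · obtain rfl : i = j := Fin.ext hi
          exact hxw
      by_cases hxw : B x w ≠ 0
      · obtain ⟨h', hh', hxw', hfix'⟩ := exists_map_eq_of_transvection_mem hB hG hxw
        refine ⟨h', hh', hxw', fun i hi => hfix' _ ?_⟩
        rw [map_add, LinearMap.add_apply, hx hi, CharTwo.add_self_eq_zero]
      push Not at hxw
      obtain ⟨m, hm, hmw, hmx⟩ : ∃ m, (∀ i, i.val < k → B m (b i) = 0) ∧ B m w ≠ 0 ∧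
          B m x ≠ 0 := by
        obtain ⟨m₁, hm₁⟩ := (B.toDual hB').surjective (b.coord j)
        have hb (i) : B m₁ (b i) = if i = j then 1 else 0 := by
          rw [← LinearMap.BilinForm.toDual_def hB', hm₁, b.coord_apply, b.repr_self,
            Finsupp.single_apply]
        have h₁ {i : Fin _} (hi : i.val < k) : B m₁ (b i) = 0 := by
          rw [hb, if_neg]; rintro rfl; exact hi.ne rfl
        have h₁w : B m₁ w = 1 := by rw [hb, if_pos rfl]
        have h₂ {i : Fin _} (hi : i.val < k) : B (h (g m₁)) (b i) = 0 := by
          rw [← h₁ hi, ← hiso m₁, hfix i hi]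
        have h₂x : B (h (g m₁)) x = 1 := by rw [hiso, h₁w]
        by_cases hc : B m₁ x ≠ 0
        · exact ⟨m₁, fun i => h₁, by simp [h₁w], hc⟩
        by_cases hc' : B (h (g m₁)) w ≠ 0
        · exact ⟨_, fun i => h₂, hc', by simp [h₂x]⟩
        push Not at hc hc'
        exact ⟨m₁ + h (g m₁), fun i hi => by simp [h₁ hi, h₂ hi], by simp [h₁w, hc'],
          by simp [h₂x, hc]⟩
      obtain ⟨h₁, hh₁, hxz, hfix₁⟩ := exists_map_eq_of_transvection_mem hB hG (x := x) (y := w + m)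
        (by rwa [map_add, hxw, zero_add, hB.apply_comm])
      obtain ⟨h₂, hh₂, hzw, hfix₂⟩ := exists_map_eq_of_transvection_mem hB hG (x := w + m) (y := w)
        (by simpa [hB w] using hmw)
      refine ⟨h₂ * h₁, mul_mem hh₂ hh₁, ?_, fun i hi => ?_⟩
      · rw [LinearEquiv.mul_apply, hxz, hzw]
      · rw [LinearEquiv.mul_apply, hfix₁, hfix₂]
        · simp [hm i hi, CharTwo.add_self_eq_zero]
        · simp [hm i hi, hx hi, CharTwo.add_self_eq_zero]
  obtain ⟨h, hh, hfix⟩ := key _ le_rfl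
  have : h * g = 1 := by
    apply LinearEquiv.toLinearMap_injective
    exact b.ext fun i => hfix i i.2
  rw [eq_inv_of_mul_eq_one_right this]
  exact inv_mem hh

end Generation

section TransvectionSet

open Polynomial LinearMap

variable {F V : Type*} [Field F] [AddCommGroup V] [Module F V]

/-- The vectors whose transvection `z ↦ z + B v z • v` lies in `G`. -/
def transvectionSet (B : LinearMap.BilinForm F V) (G : Subgroup (V ≃ₗ[F] V)) : Set V :=
  {v | ∃ g ∈ G, ∀ z, g z = z + B v z • v}

variable {B : LinearMap.BilinForm F V} {G : Subgroup (V ≃ₗ[F] V)}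

theorem map_mem_transvectionSet (hGB : ∀ g ∈ G, ∀ x y, B (g x) (g y) = B x y) {g : V ≃ₗ[F] V}
    (hg : g ∈ G) {v : V} (hv : v ∈ transvectionSet B G) : g v ∈ transvectionSet B G := by
  obtain ⟨h, hh, hhz⟩ := hv
  refine ⟨g * h * g⁻¹, mul_mem (mul_mem hg hh) (inv_mem hg), fun z => ?_⟩
  have hz : g (g⁻¹ z) = z := g.apply_symm_apply z
  rw [LinearEquiv.mul_apply, LinearEquiv.mul_apply, hhz, map_add, map_smul, hz,
    ← hGB g hg v, hz]

theorem isTransvectionClosed_transvectionSet [CharP F 2]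
    (hGB : ∀ g ∈ G, ∀ x y, B (g x) (g y) = B x y)
    (hB : B.IsAlt) : IsTransvectionClosed B (transvectionSet B G) where
  zero_mem := ⟨1, one_mem _, by simp⟩
  transvection_mem := by
    rintro u v ⟨g, hg, hgz⟩ hv
    rw [transvection.apply, ← hgz]
    exact map_mem_transvectionSet hGB hg hv
  add_smul_mem := by
    rintro u c d ⟨g, hg, hgz⟩ ⟨h, hh, hhz⟩
    refine ⟨g * h, mul_mem hg hh, fun z => ?_⟩
    rw [LinearEquiv.mul_apply, hhz, hgz]
    simp only [map_smul, map_add, LinearMap.smul_apply, smul_eq_mul, hB u]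
    linear_combination (norm := module) -(B u z * c * d * CharTwo.two_eq_zero (R := F)) • u

theorem smul_mem_transvectionSet [CharP F 2] [Finite F] {g : V ≃ₗ[F] V} (hg : g ∈ G) {b e κ c : F}
    (hb : b ≠ 0) (he : e ≠ 0) (hc : c ^ 2 * e = κ) {v : V} (hv : g v = v)
    (hgz : ∀ z, g (g (g (g (g z)))) + (b + 1) • g (g (g (g z))) + (e + b) • g (g (g z)) +
      (b + e) • g (g z) + (1 + b) • g z + z = κ • B v z • v) :
    c • v ∈ transvectionSet B G := by
  have h2 : (2 : F) = 0 := CharTwo.two_eq_zero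
  have hC2 : (2 : F[X]) = 0 := by rw [← C_ofNat, h2, C_0]
  have hCb : C b⁻¹ * C b = (1 : F[X]) := by rw [← C_mul, inv_mul_cancel₀ hb, C_1]
  have hCe : C e⁻¹ * C e = (1 : F[X]) := by rw [← C_mul, inv_mul_cancel₀ he, C_1]
  let r : F[X] := X ^ 4 + C b * X ^ 3 + C e * X ^ 2 + C b * X + 1
  have hr : r.Separable := by
    refine ⟨C e⁻¹, - C e⁻¹ * (X ^ 2 + C b * X + C e + 1) * C b⁻¹, ?_⟩
    simp only [r, derivative_add, derivative_mul, derivative_X_pow, derivative_C, derivative_X,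
      derivative_one]
    simp only [Nat.cast_ofNat, C_ofNat]
    linear_combination -hCe - (1 + C e⁻¹ * X ^ 2) * hC2 -
      C e⁻¹ * (X ^ 2 + C b * X + C e + 1) * ((X ^ 2 + 1) * hCb +
        C b⁻¹ * (2 * X ^ 3 + C b * X ^ 2 + C e * X) * hC2)
  have hrm : r.Monic := by
    simp only [r]
    monicity!
  have hr1 : r.eval 1 = e := by
    simp only [r, eval_add, eval_mul, eval_pow, eval_X, eval_C, eval_one]
    linear_combination (1 + b) * h2
  obtain ⟨N, hN, hrN⟩ := exists_odd_dvd_X_pow_sub_one hr hrm (by simp [r, coeff_zero_eq_eval_zero])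
  have hcop : IsCoprime (X - 1 : F[X]) r := by
    rw [← C_1]
    exact (irreducible_X_sub_C 1).coprime_iff_not_dvd.2 (by
      rw [dvd_iff_isRoot, IsRoot.def, hr1]; exact he)
  obtain ⟨w, hw⟩ := hcop.mul_dvd (by simpa using sub_dvd_pow_sub_pow (X : F[X]) 1 N) hrN
  have hw1 : e * w.eval 1 = 1 := by
    have := congrArg (fun p => (derivative p).eval 1) hw
    simp only [derivative_sub, derivative_mul, derivative_X_pow, derivative_X, derivative_one,
      eval_sub, eval_mul, eval_add, eval_pow, eval_X, eval_one, hr1, eval_C] at this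
    obtain ⟨m, rfl⟩ := hN
    push_cast at this
    simp at this
    linear_combination -this + m * h2
  have hwv (p : F[X]) : aeval (g : Module.End F V) p v = p.eval 1 • v := by
    induction p using Polynomial.induction_on' with
    | add p q hp hq => simp [hp, hq, add_smul]
    | monomial n d =>
      have hn : ((g : Module.End F V) ^ n) v = v := by
        induction n with
        | zero => rfl
        | succ n ih => rw [pow_succ, Module.End.mul_apply, LinearEquiv.coe_coe, hv, ih]
      simp [hn]
  have hpow (n : ℕ) (z : V) : (g ^ n) z = ((g : Module.End F V) ^ n) z := by
    induction n generalizing z with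
    | zero => rfl
    | succ n ih => rw [pow_succ, pow_succ, LinearEquiv.mul_apply, ih]; rfl
  refine ⟨g ^ N, pow_mem hg N, fun z => ?_⟩
  have hrz : aeval (g : Module.End F V) ((X - 1) * r) z = (κ * B v z) • v := by
    rw [mul_smul, ← hgz]
    simp only [r, map_mul, map_add, map_sub, aeval_X, aeval_C, map_one,
      Module.End.mul_apply, LinearMap.sub_apply, LinearMap.add_apply, Module.End.one_apply,
      Module.algebraMap_end_apply, pow_succ, pow_zero, one_mul, LinearEquiv.coe_coe, map_smul]
    linear_combination (norm := module)
      -h2 • (g (g (g (g z))) + b • g (g (g z)) + e • g (g z) + b • g z + z)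
  have := congrArg (fun p => aeval (g : Module.End F V) p z) hw
  simp only [mul_comm _ w, map_mul _ w] at this
  rw [Module.End.mul_apply, hrz, map_smul, hwv, map_sub, map_pow, aeval_X, map_one,
    LinearMap.sub_apply, Module.End.one_apply, ← hpow, sub_eq_iff_eq_add'] at this
  rw [this, map_smul, LinearMap.smul_apply, smul_eq_mul, ← hc]
  linear_combination (norm := module) (c ^ 2 * B v z * hw1) • v

end TransvectionSet

section Evaluation

variable {F : Type*} [Field F]

/-- The value at `a` of the polynomial over `𝔽₂` whose coefficients are the binary digits of `n`. -/
def evalBits (a : F) (n : ℕ) : F :=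
  if n = 0 then 0 else (n % 2 : ℕ) + a * evalBits a (n / 2)

theorem evalBits_zero (a : F) : evalBits a 0 = 0 := by rw [evalBits, if_pos rfl]

theorem evalBits_eq (a : F) (n : ℕ) : evalBits a n = (n % 2 : ℕ) + a * evalBits a (n / 2) := by
  rcases eq_or_ne n 0 with rfl | hn
  · simp [evalBits_zero]
  · rw [evalBits, if_neg hn]

theorem evalBits_one (a : F) : evalBits a 1 = 1 := by
  rw [evalBits_eq]; simp [evalBits_zero]

theorem evalBits_two_mul (a : F) (n : ℕ) : evalBits a (2 * n) = a * evalBits a n := by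
  rw [evalBits_eq]; simp

theorem evalBits_xor [CharP F 2] (a : F) (m n : ℕ) :
    evalBits a (m ^^^ n) = evalBits a m + evalBits a n := by
  induction m using Nat.strong_induction_on generalizing n with
  | _ m ih =>
    rcases eq_or_ne m 0 with rfl | hm
    · simp [evalBits_zero]
    have h2 : (2 : F) = 0 := CharTwo.two_eq_zero
    rw [evalBits_eq a (m ^^^ n), evalBits_eq a m, evalBits_eq a n, Nat.xor_div_two,
      ih _ (by omega)]
    rw [Nat.xor_mod_two_eq]
    rcases Nat.mod_two_eq_zero_or_one m with h | h <;>
    rcases Nat.mod_two_eq_zero_or_one n with h' | h' <;>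
    simp [Nat.add_mod, h, h'] <;> grind

/-- The exponents in `l` list the monomials of a polynomial, by which `n` is multiplied. -/
def mulBits (l : List ℕ) (n : ℕ) : ℕ :=
  l.foldr (fun i s => n * 2 ^ i ^^^ s) 0

/-- The sum of the powers of `a` with exponents in `l`. -/
def powSum (a : F) (l : List ℕ) : F :=
  (l.map (a ^ ·)).sum

theorem evalBits_mulBits [CharP F 2] (a : F) (l : List ℕ) (n : ℕ) :
    evalBits a (mulBits l n) = powSum a l * evalBits a n := by
  have hpow (i : ℕ) : evalBits a (n * 2 ^ i) = a ^ i * evalBits a n := by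
    induction i with
    | zero => simp
    | succ i ih => rw [pow_succ', mul_left_comm, evalBits_two_mul, ih]; ring
  induction l with
  | nil => simp [mulBits, powSum, evalBits_zero]
  | cons i l ih =>
    simp only [mulBits, powSum, List.foldr_cons, List.map_cons, List.sum_cons] at ih ⊢
    rw [evalBits_xor, ih, hpow]
    ring

end Evaluation

section Forms

variable {F : Type*} [Field F]

/-- The involution `x`. -/
def matX (a : F) : Matrix (Fin 6) (Fin 6) F :=
  !![0,0,1,0,0,0; 0,0,0,1,0,0; 1,0,0,0,0,0; 0,1,0,0,0,0; 0,0,0,0,1,0; 0,0,0,0,a,1]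

/-- The element `y` of order three. -/
def matY (a : F) : Matrix (Fin 6) (Fin 6) F :=
  !![1,0,0,1,1,0; 0,1,0,0,0,0; 0,0,0,1,0,0; 0,0,1,1,0,0; 0,a,1,1,1,1; 0,a,1,0,1,0]

/-- The Gram matrix `J`. -/
def matJ (a : F) : Matrix (Fin 6) (Fin 6) F :=
  !![0,1,0,0,0,0; 1,0,0,a,a+1,1; 0,0,0,1,0,0; 0,a,1,0,1,1; 0,a+1,0,1,0,1; 0,1,0,1,1,0]

theorem matX_mulVec (a : F) (v : Fin 6 → F) :
    matX a *ᵥ v = ![v 2, v 3, v 0, v 1, v 4, a * v 4 + v 5] := by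
  ext i
  fin_cases i <;> simp [matX, mulVec, dotProduct, Fin.sum_univ_six]

theorem matY_mulVec (a : F) (v : Fin 6 → F) :
    matY a *ᵥ v = ![v 0 + v 3 + v 4, v 1, v 3, v 2 + v 3, a * v 1 + v 2 + v 3 + v 4 + v 5,
      a * v 1 + v 2 + v 4] := by
  ext i
  fin_cases i <;> simp [matY, mulVec, dotProduct, Fin.sum_univ_six]

theorem toBilin'_matJ_apply (a : F) (u v : Fin 6 → F) :
    Matrix.toBilin' (matJ a) u v = u 0 * v 1 + u 1 * (v 0 + a * v 3 + (a + 1) * v 4 + v 5) +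
      u 2 * v 3 + u 3 * (a * v 1 + v 2 + v 4 + v 5) + u 4 * ((a + 1) * v 1 + v 3 + v 5) +
      u 5 * (v 1 + v 3 + v 4) := by
  simp [Matrix.toBilin'_apply', matJ, mulVec, dotProduct, Fin.sum_univ_six]

theorem isAlt_toBilin'_matJ [CharP F 2] (a : F) : (Matrix.toBilin' (matJ a)).IsAlt := by
  intro v
  have h2 : (2 : F) = 0 := CharTwo.two_eq_zero
  rw [toBilin'_matJ_apply]
  grind

theorem nondegenerate_toBilin'_matJ [CharP F 2] (a : F) :
    (Matrix.toBilin' (matJ a)).Nondegenerate := by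
  have h (u : Fin 6 → F) (hu : ∀ v, Matrix.toBilin' (matJ a) u v = 0) : u = 0 := by
    have h (i : Fin 6) := hu (Pi.single i 1)
    simp only [toBilin'_matJ_apply] at h
    have h0 := h 0
    have h1 := h 1
    have h2 := h 2
    have h3 := h 3
    have h4 := h 4
    have h5 := h 5
    simp at h0 h1 h2 h3 h4 h5
    ext i
    fin_cases i <;> simp <;> grind
  refine ⟨h, fun u hu => h u fun v => ?_⟩
  rw [(isAlt_toBilin'_matJ a).apply_comm, hu]

theorem toBilin'_matJ_matX [CharP F 2] (a : F) (u v : Fin 6 → F) :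
    Matrix.toBilin' (matJ a) (matX a *ᵥ u) (matX a *ᵥ v) = Matrix.toBilin' (matJ a) u v := by
  have h2 : (2 : F) = 0 := CharTwo.two_eq_zero
  simp only [toBilin'_matJ_apply, matX_mulVec]
  simp
  grind

theorem toBilin'_matJ_matY [CharP F 2] (a : F) (u v : Fin 6 → F) :
    Matrix.toBilin' (matJ a) (matY a *ᵥ u) (matY a *ᵥ v) = Matrix.toBilin' (matJ a) u v := by
  have h2 : (2 : F) = 0 := CharTwo.two_eq_zero
  simp only [toBilin'_matJ_apply, matY_mulVec]
  simp
  grind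

theorem matX_mul_matX [CharP F 2] (a : F) : matX a * matX a = 1 := by
  have h2 : (2 : F) = 0 := CharTwo.two_eq_zero
  refine Matrix.toLin'.injective (LinearMap.ext fun v => ?_)
  simp only [toLin'_apply, ← mulVec_mulVec, matX_mulVec, one_mulVec]
  ext i
  fin_cases i <;> simp
  grind

theorem matY_mul_matY_mul_matY [CharP F 2] (a : F) : matY a * (matY a * matY a) = 1 := by
  have h2 : (2 : F) = 0 := CharTwo.two_eq_zero
  refine Matrix.toLin'.injective (LinearMap.ext fun v => ?_)
  simp only [toLin'_apply, ← mulVec_mulVec, matY_mulVec, one_mulVec]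
  ext i
  fin_cases i <;> simp <;> grind

end Forms

section Reflection

/-- Vectors of length six whose entries encode polynomials over `𝔽₂` by their binary digits. -/
@[ext]
structure BitVec6 where
  (p₀ p₁ p₂ p₃ p₄ p₅ : ℕ)

namespace BitVec6

instance : DecidableEq BitVec6 := fun _ _ => decidable_of_iff _ BitVec6.ext_iff.symm

/-- The action of `x`, where `m` is multiplication by `a`. -/
def applyX (m : ℕ → ℕ) (v : BitVec6) : BitVec6 :=
  ⟨v.p₂, v.p₃, v.p₀, v.p₁, v.p₄, m v.p₄ ^^^ v.p₅⟩

/-- The action of `y`, where `m` is multiplication by `a`. -/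
def applyY (m : ℕ → ℕ) (v : BitVec6) : BitVec6 :=
  ⟨v.p₀ ^^^ v.p₃ ^^^ v.p₄, v.p₁, v.p₃, v.p₂ ^^^ v.p₃,
    m v.p₁ ^^^ v.p₂ ^^^ v.p₃ ^^^ v.p₄ ^^^ v.p₅, m v.p₁ ^^^ v.p₂ ^^^ v.p₄⟩

/-- The action of a word in `x` (encoded by `true`) and `y` (encoded by `false`). -/
def applyWord (m : ℕ → ℕ) (s : List Bool) (v : BitVec6) : BitVec6 :=
  s.foldr (fun l u => if l then u.applyX m else u.applyY m) v

/-- Entrywise addition. -/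
def add (u v : BitVec6) : BitVec6 :=
  ⟨u.p₀ ^^^ v.p₀, u.p₁ ^^^ v.p₁, u.p₂ ^^^ v.p₂, u.p₃ ^^^ v.p₃, u.p₄ ^^^ v.p₄, u.p₅ ^^^ v.p₅⟩

/-- Multiplication by a polynomial, given by the exponents of its monomials. -/
def mul (l : List ℕ) (v : BitVec6) : BitVec6 :=
  ⟨mulBits l v.p₀, mulBits l v.p₁, mulBits l v.p₂, mulBits l v.p₃, mulBits l v.p₄, mulBits l v.p₅⟩

/-- The standard basis. -/
def single (j : Fin 6) : BitVec6 :=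
  ⟨if j = 0 then 1 else 0, if j = 1 then 1 else 0, if j = 2 then 1 else 0, if j = 3 then 1 else 0,
    if j = 4 then 1 else 0, if j = 5 then 1 else 0⟩

/-- The vector `(1, a, 0, 1 + a, 1, a ^ 2)`. -/
def center : BitVec6 := ⟨1, 2, 0, 3, 1, 4⟩

/-- The value of the symplectic form on `center` and `v`. -/
def centerForm (v : BitVec6) : ℕ :=
  2 * v.p₀ ^^^ mulBits [0, 1] v.p₂ ^^^ v.p₃ ^^^ v.p₄

variable {F : Type*} [Field F]

/-- The vector over `F` encoded by `v`. -/
def eval (a : F) (v : BitVec6) : Fin 6 → F :=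
  ![evalBits a v.p₀, evalBits a v.p₁, evalBits a v.p₂, evalBits a v.p₃, evalBits a v.p₄,
    evalBits a v.p₅]

theorem eval_applyX [CharP F 2] {a : F} {m : ℕ → ℕ} (hm : ∀ n, evalBits a (m n) = a * evalBits a n)
    (v : BitVec6) : (v.applyX m).eval a = matX a *ᵥ v.eval a := by
  simp [matX_mulVec, eval, applyX, evalBits_xor, hm]

theorem eval_applyY [CharP F 2] {a : F} {m : ℕ → ℕ} (hm : ∀ n, evalBits a (m n) = a * evalBits a n)
    (v : BitVec6) : (v.applyY m).eval a = matY a *ᵥ v.eval a := by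
  simp [matY_mulVec, eval, applyY, evalBits_xor, hm]

theorem eval_add [CharP F 2] (a : F) (u v : BitVec6) :
    (u.add v).eval a = u.eval a + v.eval a := by
  simp [eval, add, evalBits_xor]

theorem eval_mul [CharP F 2] (a : F) (l : List ℕ) (v : BitVec6) :
    (v.mul l).eval a = powSum a l • v.eval a := by
  simp [eval, mul, evalBits_mulBits]

theorem eval_single (a : F) (j : Fin 6) : (single j).eval a = Pi.single j 1 := by
  ext i
  fin_cases j <;> fin_cases i <;> simp [eval, single, evalBits_zero, evalBits_one]

theorem eval_center [CharP F 2] (a : F) : center.eval a = ![1, a, 0, 1 + a, 1, a ^ 2] := by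
  have h2 : evalBits a 2 = a := by simpa [evalBits_one] using evalBits_two_mul a 1
  have h4 : evalBits a 4 = a ^ 2 := by simpa [h2, pow_two] using evalBits_two_mul a 2
  have h3 : evalBits a 3 = 1 + a := by simpa [evalBits_one, h2] using evalBits_xor a 1 2
  simp [eval, center, evalBits_zero, evalBits_one, h2, h3, h4]

theorem evalBits_centerForm [CharP F 2] (a : F) (v : BitVec6) :
    evalBits a v.centerForm = Matrix.toBilin' (matJ a) (center.eval a) (v.eval a) := by
  have h2 : (2 : F) = 0 := CharTwo.two_eq_zero
  rw [eval_center, toBilin'_matJ_apply]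
  simp [eval, centerForm, evalBits_xor, evalBits_mulBits, powSum, evalBits_two_mul]
  grind

/-- The relation
`w ^ 5 + (b + 1) w ^ 4 + (e + b) w ^ 3 + (b + e) w ^ 2 + (1 + b) w + 1 = κ B(v, ·) v`
on the standard basis, where `w` is the value of the word `s`, `v` is `center`, and `b`, `e`, `κ`
are polynomials given by the exponents of their monomials; moreover `w` fixes `v`. -/
def IsTransvectionWord (s : List Bool) (b e κ : List ℕ) : Prop :=
  center.applyWord (2 * ·) s = center ∧ ∀ j : Fin 6,
    let u₀ := single j
    let u₁ := u₀.applyWord (2 * ·) s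
    let u₂ := u₁.applyWord (2 * ·) s
    let u₃ := u₂.applyWord (2 * ·) s
    let u₄ := u₃.applyWord (2 * ·) s
    let u₅ := u₄.applyWord (2 * ·) s
    (((((u₅.add (u₄.mul (b ++ [0]))).add (u₃.mul (e ++ b))).add (u₂.mul (b ++ e))).add
      (u₁.mul (0 :: b))).add u₀) =
      (⟨mulBits [0] u₀.centerForm, mulBits [1] u₀.centerForm, 0, mulBits [0, 1] u₀.centerForm,
        mulBits [0] u₀.centerForm, mulBits [2] u₀.centerForm⟩ : BitVec6).mul κ

instance (s : List Bool) (b e κ : List ℕ) : Decidable (IsTransvectionWord s b e κ) := by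
  unfold IsTransvectionWord; infer_instance

/-- The product of the elements `x y` (encoded by `true`) and `x y ^ 2` (encoded by `false`). -/
def modularWord (s : List Bool) : List Bool :=
  s.flatMap fun l => if l then [true, false] else [true, false, false]

theorem isTransvectionWord₁ : IsTransvectionWord
    (modularWord [true, true, true, false, false, false, true, false, true, false])
    [10] [6] [5, 7] := by
  decide +kernel

theorem isTransvectionWord₂ : IsTransvectionWord
    (modularWord [true, true, true, false, true, true, false, true, false, true, false])
    [6, 7, 8, 10, 11] [6, 10] [5, 9] := by
  decide +kernel

theorem isTransvectionWord₃ : IsTransvectionWord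
    (modularWord [true, true, true, false, false, false, true, false, true, false,
      true, true, true, false, true, true, false, true, false, true, false])
    [8, 10, 16, 17, 18, 20, 21] [8, 12, 14, 16, 18] [9, 13, 15, 17, 19] := by
  decide +kernel

/-- Words whose values map `center` to vectors which span together with `center`. -/
def spanningWord : Fin 5 → List Bool :=
  ![[false, false], [false, true], [false, false, true], [true, false, false],
    [false, true, false, true]]

/-- The coordinates of the standard basis with respect to `center` and its images under
`spanningWord`. -/
def spanningCoord : Fin 6 → Fin 6 → List ℕ :=
  ![![[0, 3, 4], [0, 2, 3, 5, 6], [0, 1, 2, 3, 4], [1, 3, 6], [5], [0, 2, 3]],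
    ![[0, 1, 4], [0, 1, 2, 6], [1, 2, 4], [0, 3, 4, 5, 6], [0, 1, 3, 4, 5], [3]],
    ![[0, 3, 4], [1, 2, 3, 5, 6], [0, 1, 2, 3, 4], [3, 6], [0, 5], [0, 2, 3]],
    ![[1], [3], [1], [0, 1, 2, 3], [0, 1, 2], [0]],
    ![[2], [0, 1, 4], [0, 2], [0, 2, 3, 4], [0, 1, 2, 3], [1]],
    ![[0, 1, 2, 3], [1, 3, 4, 5], [2, 3], [0, 2, 3, 5], [2, 4], [0, 1, 2]]]

theorem single_eq_spanningCoord : ∀ j, single j = (center.mul (spanningCoord j 0)).add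
    (((((center.applyWord (2 * ·) (spanningWord 0)).mul (spanningCoord j 1)).add
      ((center.applyWord (2 * ·) (spanningWord 1)).mul (spanningCoord j 2))).add
      ((center.applyWord (2 * ·) (spanningWord 2)).mul (spanningCoord j 3))).add
      (((center.applyWord (2 * ·) (spanningWord 3)).mul (spanningCoord j 4)).add
      ((center.applyWord (2 * ·) (spanningWord 4)).mul (spanningCoord j 5)))) := by
  decide +kernel

theorem centerForm_spanningWord : ∀ i,
    (center.applyWord (2 * ·) (spanningWord i)).centerForm =
      (![mulBits [1] 1, mulBits [0] 1, mulBits [0, 1] 1, mulBits [0] 1, mulBits [0, 2] 1] :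
        Fin 5 → ℕ) i := by
  decide +kernel

/-- Images of the vector `(1, 1, 0, 0, 1, 1)` over `𝔽₂`. -/
def binaryOrbit : ℕ → List BitVec6
  | 0 => [⟨1, 1, 0, 0, 1, 1⟩]
  | n + 1 =>
    let l := (binaryOrbit n ++ (binaryOrbit n).map (applyX id)).dedup
    (l ++ l.map (applyY id)).dedup

theorem mem_binaryOrbit : ∀ f : Fin 6 → Fin 2,
    (⟨f 0, f 1, f 2, f 3, f 4, f 5⟩ : BitVec6) ∈
      (⟨0, 0, 0, 0, 0, 0⟩ : BitVec6) :: binaryOrbit 9 := by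
  decide +kernel

end BitVec6

end Reflection

section Words

variable {F : Type*} [Field F] {a : F} {G : Subgroup ((Fin 6 → F) ≃ₗ[F] (Fin 6 → F))}
  {gX gY : (Fin 6 → F) ≃ₗ[F] (Fin 6 → F)}

open BitVec6

theorem exists_mem_apply_eval_eq [CharP F 2] (hgX : gX ∈ G) (hgY : gY ∈ G)
    (hX : ∀ v, gX v = matX a *ᵥ v) (hY : ∀ v, gY v = matY a *ᵥ v) (s : List Bool) :
    ∃ g ∈ G, ∀ v : BitVec6, g (v.eval a) = (v.applyWord (2 * ·) s).eval a := by
  induction s with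
  | nil => exact ⟨1, one_mem _, fun v => rfl⟩
  | cons l s ih =>
    obtain ⟨g, hg, hgv⟩ := ih
    cases l
    · refine ⟨gY * g, mul_mem hgY hg, fun v => ?_⟩
      rw [LinearEquiv.mul_apply, hgv, hY, ← eval_applyY (evalBits_two_mul a)]
      rfl
    · refine ⟨gX * g, mul_mem hgX hg, fun v => ?_⟩
      rw [LinearEquiv.mul_apply, hgv, hX, ← eval_applyX (evalBits_two_mul a)]
      rfl

theorem smul_center_mem_transvectionSet [CharP F 2] [Finite F] (hgX : gX ∈ G) (hgY : gY ∈ G)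
    (hX : ∀ v, gX v = matX a *ᵥ v) (hY : ∀ v, gY v = matY a *ᵥ v) {s : List Bool}
    {b e κ : List ℕ} (hs : IsTransvectionWord s b e κ) (hb : powSum a b ≠ 0)
    (he : powSum a e ≠ 0) {c : F} (hc : c ^ 2 * powSum a e = powSum a κ) :
    c • center.eval a ∈ transvectionSet (Matrix.toBilin' (matJ a)) G := by
  obtain ⟨g, hg, hgv⟩ := exists_mem_apply_eval_eq hgX hgY hX hY s
  refine smul_mem_transvectionSet hg hb he hc (by rw [hgv, hs.1]) fun z => ?_
  let T : Module.End F (Fin 6 → F) := g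
  set b' := powSum a b with hb'
  set e' := powSum a e
  set κ' := powSum a κ
  suffices h : T ^ 5 + (b' + 1) • T ^ 4 + (e' + b') • T ^ 3 + (b' + e') • T ^ 2 + (1 + b') • T + 1 =
      κ' • (Matrix.toBilin' (matJ a) (center.eval a)).smulRight (center.eval a) by
    exact congrArg (fun f : Module.End F (Fin 6 → F) => f z) h
  refine (Pi.basisFun F (Fin 6)).ext fun j => ?_
  have h := congrArg (BitVec6.eval a) (hs.2 j)
  have happ (l₁ l₂ : List ℕ) : powSum a (l₁ ++ l₂) = powSum a l₁ + powSum a l₂ := by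
    simp [powSum]
  have h0 : powSum a [0] = 1 := by simp [powSum]
  have hcons : powSum a (0 :: b) = 1 + b' := by simp [powSum, hb']
  simp only [eval_add, eval_mul, ← hgv, happ, h0, hcons] at h
  rw [Pi.basisFun_apply, ← eval_single]
  refine h.trans ?_
  have hval : BitVec6.eval a ⟨mulBits [0] (single j).centerForm, mulBits [1] (single j).centerForm,
      0, mulBits [0, 1] (single j).centerForm, mulBits [0] (single j).centerForm,
      mulBits [2] (single j).centerForm⟩ =
      Matrix.toBilin' (matJ a) (center.eval a) ((single j).eval a) • center.eval a := by
    rw [← evalBits_centerForm, eval_center]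
    simp [BitVec6.eval, evalBits_mulBits, evalBits_zero, powSum, mul_comm]
  rw [hval]
  rfl

theorem span_center_eq_top [CharP F 2] (a : F) :
    Submodule.span F (insert (center.eval a) (Set.range fun i : Fin 5 =>
      (center.applyWord (2 * ·) (spanningWord i)).eval a)) = ⊤ := by
  rw [eq_top_iff, ← (Pi.basisFun F (Fin 6)).span_eq, Submodule.span_le]
  rintro _ ⟨j, rfl⟩
  rw [Pi.basisFun_apply, ← eval_single, single_eq_spanningCoord]
  simp only [eval_add, eval_mul]
  have h (i : Fin 5) := Submodule.subset_span (R := F) (s := insert (center.eval a) (Set.range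
    fun i : Fin 5 => (center.applyWord (2 * ·) (spanningWord i)).eval a))
    (Set.mem_insert_of_mem _ (Set.mem_range_self i))
  have h' := Submodule.subset_span (R := F) (s := insert (center.eval a) (Set.range
    fun i : Fin 5 => (center.applyWord (2 * ·) (spanningWord i)).eval a)) (Set.mem_insert _ _)
  exact add_mem (Submodule.smul_mem _ _ h') (add_mem (add_mem (add_mem
    (Submodule.smul_mem _ _ (h 0)) (Submodule.smul_mem _ _ (h 1))) (Submodule.smul_mem _ _ (h 2)))
    (add_mem (Submodule.smul_mem _ _ (h 3)) (Submodule.smul_mem _ _ (h 4))))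

theorem toBilin'_center_spanningWord [CharP F 2] (a : F) (i : Fin 5) :
    Matrix.toBilin' (matJ a) (center.eval a) ((center.applyWord (2 * ·) (spanningWord i)).eval a) =
      (![a, 1, 1 + a, 1, (1 + a) ^ 2] : Fin 5 → F) i := by
  have h2 : (2 : F) = 0 := CharTwo.two_eq_zero
  rw [← evalBits_centerForm, centerForm_spanningWord]
  fin_cases i <;> simp [evalBits_mulBits, powSum, evalBits_one]
  linear_combination -a * h2

end Words

section Main

variable {F : Type*} [Field F] {a : F} {G : Subgroup ((Fin 6 → F) ≃ₗ[F] (Fin 6 → F))}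
  {gX gY : (Fin 6 → F) ≃ₗ[F] (Fin 6 → F)}

open BitVec6

theorem mem_transvectionSet_of_ne_one [CharP F 2] [Finite F] (ha : a ≠ 0) (ha1 : a ≠ 1)
    (hgen : Subfield.closure {a} = ⊤) (hgX : gX ∈ G) (hgY : gY ∈ G)
    (hX : ∀ v, gX v = matX a *ᵥ v) (hY : ∀ v, gY v = matY a *ᵥ v)
    (hGB : ∀ g ∈ G, ∀ x y, Matrix.toBilin' (matJ a) (g x) (g y) = Matrix.toBilin' (matJ a) x y)
    (v : Fin 6 → F) : v ∈ transvectionSet (Matrix.toBilin' (matJ a)) G := by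
  have h2 : (2 : F) = 0 := CharTwo.two_eq_zero
  have hB := isAlt_toBilin'_matJ a
  have hS := isTransvectionClosed_transvectionSet hGB hB
  have ha1' : 1 + a ≠ 0 := fun h => ha1 (by linear_combination h - h2)
  have hword {s : List Bool} {b e κ : List ℕ} (hs : IsTransvectionWord s b e κ) {c : F}
      (hb : powSum a b ≠ 0) (he : powSum a e ≠ 0) (hc : c ^ 2 * powSum a e = powSum a κ) :=
    smul_center_mem_transvectionSet hgX hgY hX hY hs hb he hc
  have horbit {c : F} (hc : c • center.eval a ∈ transvectionSet (Matrix.toBilin' (matJ a)) G)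
      (i : Fin 5) : c • (center.applyWord (2 * ·) (spanningWord i)).eval a ∈
        transvectionSet (Matrix.toBilin' (matJ a)) G := by
    obtain ⟨g, hg, hgv⟩ := exists_mem_apply_eval_eq hgX hgY hX hY (spanningWord i)
    rw [← hgv, ← map_smul]
    exact map_mem_transvectionSet hGB hg hc
  obtain ⟨c, hc⟩ := isSquare_of_charTwo' ((1 + a ^ 2) / a)
  have hc' : c ^ 2 * a = (1 + a) ^ 2 := by
    rw [pow_two, ← hc, div_mul_cancel₀ _ ha]
    linear_combination -a * h2
  have hc0 : c ≠ 0 := by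
    rintro rfl
    exact pow_ne_zero 2 ha1' (by simpa using hc'.symm)
  have hu := hword isTransvectionWord₁ (c := c) (by simpa [powSum] using ha)
    (by simpa [powSum] using ha) (by
      simp only [powSum, List.map_cons, List.map_nil, List.sum_cons, List.sum_nil]
      linear_combination a ^ 5 * hc' + a ^ 6 * h2)
  obtain ⟨t, ht, htS⟩ : ∃ t, a ∈ Subfield.closure {t} ∧
      (c * t) • center.eval a ∈ transvectionSet (Matrix.toBilin' (matJ a)) G := by
    by_cases hp : 1 + a + a ^ 2 + a ^ 4 + a ^ 5 = 0
    · have hb : powSum a [8, 10, 16, 17, 18, 20, 21] =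
          a ^ 8 * (1 + a ^ 2 + a ^ 8 + a ^ 9 + a ^ 10 + a ^ 12 + a ^ 13) := by
        simp [powSum]; ring
      have he : powSum a [8, 12, 14, 16, 18] = a ^ 8 * (1 + a ^ 4 + a ^ 6 + a ^ 8 + a ^ 10) := by
        simp [powSum]; ring
      refine ⟨a / (1 + a), ?_, hword isTransvectionWord₃ ?_ ?_ ?_⟩
      · have h : a = a / (1 + a) * (1 + a / (1 + a))⁻¹ := by
          have : 1 + a / (1 + a) = (1 + a)⁻¹ := by
            field_simp
            linear_combination a * h2
          rw [this, inv_inv, div_mul_cancel₀ _ ha1']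
        have ht := Subfield.subset_closure (Set.mem_singleton (a / (1 + a)))
        have := mul_mem ht (inv_mem (add_mem (one_mem _) ht))
        rwa [← h] at this
      · rw [hb]
        refine mul_ne_zero (pow_ne_zero _ ha) fun h => ?_
        grind
      · rw [he]
        refine mul_ne_zero (pow_ne_zero _ ha) fun h => ?_
        grind
      · have : powSum a [9, 13, 15, 17, 19] = a * powSum a [8, 12, 14, 16, 18] := by
          simp [powSum]; ring
        rw [this, mul_div_assoc', div_pow]
        congr 1
        field_simp
        linear_combination hc'
    · refine ⟨(1 + a)⁻¹, ?_, hword isTransvectionWord₂ ?_ ?_ ?_⟩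
      · have ht := Subfield.subset_closure (Set.mem_singleton (1 + a)⁻¹)
        simpa using sub_mem (inv_mem ht) (one_mem _)
      · have : powSum a [6, 7, 8, 10, 11] = a ^ 6 * (1 + a + a ^ 2 + a ^ 4 + a ^ 5) := by
          simp [powSum]; ring
        rw [this]
        exact mul_ne_zero (pow_ne_zero _ ha) hp
      · have : powSum a [6, 10] = a ^ 6 * (1 + a) ^ 4 := by
          simp [powSum]
          linear_combination -(2 * a ^ 7 + 3 * a ^ 8 + 2 * a ^ 9) * h2
        rw [this]
        exact mul_ne_zero (pow_ne_zero _ ha) (pow_ne_zero _ ha1')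
      · simp only [powSum, List.map_cons, List.map_nil, List.sum_cons, List.sum_nil]
        field_simp
        linear_combination a ^ 5 * (1 + a ^ 4) * hc'
  have hline (d : F) : d • center.eval a ∈ transvectionSet (Matrix.toBilin' (matJ a)) G := by
    have := hS.smul_mem_of_mem_closure hB hu (horbit hu 1) (T := {t}) (c := d / c) ?_ ?_ ?_
    · rwa [smul_smul, div_mul_cancel₀ _ hc0] at this
    · simp [toBilin'_center_spanningWord, hc0]
    · rintro _ rfl
      rwa [smul_smul, mul_comm]
    · have : Subfield.closure {a} ≤ Subfield.closure {t} :=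
        Subfield.closure_le.2 (Set.singleton_subset_iff.2 ht)
      rw [hgen, top_le_iff] at this
      rw [this]
      exact Subfield.mem_top _
  have hBi (i : Fin 5) : Matrix.toBilin' (matJ a) (center.eval a)
      ((center.applyWord (2 * ·) (spanningWord i)).eval a) ≠ 0 := by
    rw [toBilin'_center_spanningWord]
    fin_cases i <;> simp [ha, ha1']
  refine hS.eq_univ_of_span_eq_top hB (nondegenerate_toBilin'_matJ a) ⟨a, ha, ha1⟩ hline
    (fun d => horbit (hline d) 0) (hBi 0) ?_ (span_center_eq_top a) v
  rintro _ ⟨i, rfl⟩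
  exact ⟨fun d => horbit (hline d) i, hBi i⟩

theorem mem_transvectionSet_one [CharP F 2] [Finite F] (hF : ∀ c : F, c = 0 ∨ c = 1)
    (hgX : gX ∈ G) (hgY : gY ∈ G)
    (hX : ∀ v, gX v = matX 1 *ᵥ v) (hY : ∀ v, gY v = matY 1 *ᵥ v)
    (hGB : ∀ g ∈ G, ∀ x y, Matrix.toBilin' (matJ 1) (g x) (g y) = Matrix.toBilin' (matJ 1) x y)
    (v : Fin 6 → F) : v ∈ transvectionSet (Matrix.toBilin' (matJ 1)) G := by
  have h2 : (2 : F) = 0 := CharTwo.two_eq_zero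
  have hv₀ := smul_center_mem_transvectionSet hgX hgY hX hY isTransvectionWord₃ (c := 1)
    (by simp [powSum]; grind) (by simp [powSum]; grind) (by simp [powSum])
  have hid (n : ℕ) : evalBits (1 : F) (id n) = 1 * evalBits 1 n := by simp
  have horbit (n : ℕ) : ∀ u ∈ binaryOrbit n,
      u.eval 1 ∈ transvectionSet (Matrix.toBilin' (matJ (1 : F))) G := by
    induction n with
    | zero =>
      rintro u hu
      obtain rfl : u = _ := List.mem_singleton.1 hu
      convert hv₀ using 1
      rw [one_smul, eval_center]
      simp [eval, evalBits_one, evalBits_zero, CharTwo.add_self_eq_zero]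
    | succ n ih =>
      have hx : ∀ u ∈ (binaryOrbit n ++ (binaryOrbit n).map (applyX id)).dedup,
          u.eval 1 ∈ transvectionSet (Matrix.toBilin' (matJ (1 : F))) G := by
        intro u hu
        rcases List.mem_append.1 (List.mem_dedup.1 hu) with hu | hu
        · exact ih u hu
        · obtain ⟨w, hw, rfl⟩ := List.mem_map.1 hu
          rw [eval_applyX hid, ← hX]
          exact map_mem_transvectionSet hGB hgX (ih w hw)
      intro u hu
      rcases List.mem_append.1 (List.mem_dedup.1 hu) with hu | hu
      · exact hx u hu
      · obtain ⟨w, hw, rfl⟩ := List.mem_map.1 hu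
        rw [eval_applyY hid, ← hY]
        exact map_mem_transvectionSet hGB hgY (hx w hw)
  have hdigit (c : F) : ∃ i : Fin 2, evalBits 1 (i : ℕ) = c := by
    rcases hF c with rfl | rfl
    · exact ⟨0, evalBits_zero 1⟩
    · exact ⟨1, evalBits_one 1⟩
  choose f hf using fun i => hdigit (v i)
  have hfv : eval 1 ⟨f 0, f 1, f 2, f 3, f 4, f 5⟩ = v := by
    ext i
    fin_cases i <;> simp [eval, hf]
  rw [← hfv]
  rcases List.mem_cons.1 (mem_binaryOrbit f) with h | h
  · rw [h]
    convert (isTransvectionClosed_transvectionSet hGB (isAlt_toBilin'_matJ 1)).zero_mem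
    simp [eval, evalBits_zero]
  · exact horbit 9 _ h

end Main

section Units

variable {F : Type*} [Field F] [CharP F 2]

/-- The involution `x` as an element of the general linear group. -/
def unitX (a : F) : GL (Fin 6) F :=
  ⟨matX a, matX a, matX_mul_matX a, matX_mul_matX a⟩

/-- The element `y` of order three as an element of the general linear group. -/
def unitY (a : F) : GL (Fin 6) F :=
  ⟨matY a, matY a * matY a, matY_mul_matY_mul_matY a, by
    rw [Matrix.mul_assoc, matY_mul_matY_mul_matY]⟩

theorem orderOf_unitX (a : F) : orderOf (unitX a) = 2 := by
  refine orderOf_eq_prime (Units.ext ?_) fun h => ?_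
  · simpa [pow_two, unitX] using matX_mul_matX a
  · simpa [unitX, matX] using congrArg (fun g : GL (Fin 6) F => g.val 0 0) h

theorem orderOf_unitY (a : F) : orderOf (unitY a) = 3 := by
  have : Fact (Nat.Prime 3) := ⟨Nat.prime_three⟩
  refine orderOf_eq_prime (Units.ext ?_) fun h => ?_
  · simpa [pow_succ', unitY] using matY_mul_matY_mul_matY a
  · simpa [unitY, matY] using congrArg (fun g : GL (Fin 6) F => g.val 2 2) h

end Units

theorem transpose_mul_mul_eq_iff_toBilin' {R n : Type*} [CommRing R] [Fintype n] [DecidableEq n]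
    {J M : Matrix n n R} : Mᵀ * J * M = J ↔
      ∀ u v, Matrix.toBilin' J (M *ᵥ u) (M *ᵥ v) = Matrix.toBilin' J u v := by
  rw [← (Matrix.toBilin' (R₁ := R) (n := n)).injective.eq_iff, LinearMap.ext_iff₂]
  refine forall₂_congr fun u v => ?_
  simp only [Matrix.toBilin'_apply', Matrix.mulVec_mulVec, dotProduct_mulVec, vecMul_mulVec,
    ← Matrix.mul_assoc]

/-- The linear automorphism of the column space given by an invertible matrix. -/
noncomputable def mulVecEquiv (F n : Type*) [Field F] [Fintype n] [DecidableEq n] :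
    GL n F ≃* ((n → F) ≃ₗ[F] (n → F)) :=
  Matrix.GeneralLinearGroup.toLin.trans (LinearMap.GeneralLinearGroup.generalLinearEquiv F (n → F))

theorem mulVecEquiv_apply {F n : Type*} [Field F] [Fintype n] [DecidableEq n] (g : GL n F)
    (v : n → F) : mulVecEquiv F n g v = (g : Matrix n n F) *ᵥ v := rfl

theorem eq_zero_or_eq_one_of_mem_closure_one {F : Type*} [Field F] [CharP F 2] {c : F}
    (hc : c ∈ Subfield.closure {(1 : F)}) : c = 0 ∨ c = 1 := by
  induction hc using Subfield.closure_induction with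
  | mem c hc => exact Or.inr hc
  | one => exact Or.inr rfl
  | add c d _ _ hc hd =>
    rcases hc with rfl | rfl <;> rcases hd with rfl | rfl <;> simp [CharTwo.add_self_eq_zero]
  | neg c _ hc => rwa [CharTwo.neg_eq]
  | inv c _ hc => rcases hc with rfl | rfl <;> simp
  | mul c d _ _ hc hd => rcases hc with rfl | rfl <;> rcases hd with rfl | rfl <;> simp

theorem transpose_mul_matJ_mul_eq_iff_mem_closure {F : Type*} [Field F] [Finite F] [CharP F 2]
    {a : F} (ha : a ≠ 0) (hgen : Subfield.closure {a} = ⊤) (g : GL (Fin 6) F) :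
    (g : Matrix (Fin 6) (Fin 6) F)ᵀ * matJ a * (g : Matrix (Fin 6) (Fin 6) F) = matJ a ↔
      g ∈ Subgroup.closure {unitX a, unitY a} := by
  set H := Subgroup.closure {unitX a, unitY a}
  have hXH : unitX a ∈ H := Subgroup.subset_closure (by simp)
  have hYH : unitY a ∈ H := Subgroup.subset_closure (by simp)
  have hH {h : GL (Fin 6) F} (hh : h ∈ H) : ∀ u v, Matrix.toBilin' (matJ a)
      ((h : Matrix (Fin 6) (Fin 6) F) *ᵥ u) ((h : Matrix (Fin 6) (Fin 6) F) *ᵥ v) =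
        Matrix.toBilin' (matJ a) u v := by
    induction hh using Subgroup.closure_induction with
    | mem h hh =>
      rcases hh with rfl | rfl
      · exact toBilin'_matJ_matX a
      · exact toBilin'_matJ_matY a
    | one => simp
    | mul g h _ _ hg hh =>
      intro u v
      rw [Units.val_mul, ← mulVec_mulVec, ← mulVec_mulVec, hg, hh]
    | inv h _ hh =>
      intro u v
      rw [← hh, mulVec_mulVec, mulVec_mulVec, ← Units.val_mul, mul_inv_cancel, Units.val_one,
        one_mulVec, one_mulVec]
  rw [transpose_mul_mul_eq_iff_toBilin']
  refine ⟨fun hg => ?_, hH⟩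
  let φ := mulVecEquiv F (Fin 6)
  let G := H.map φ.toMonoidHom
  have hGB : ∀ g ∈ G, ∀ u v, Matrix.toBilin' (matJ a) (g u) (g v) =
      Matrix.toBilin' (matJ a) u v := by
    rintro _ ⟨h, hh, rfl⟩
    exact hH hh
  have hX : φ (unitX a) ∈ G := Subgroup.mem_map_of_mem _ hXH
  have hY : φ (unitY a) ∈ G := Subgroup.mem_map_of_mem _ hYH
  have hG : ∀ v, v ∈ transvectionSet (Matrix.toBilin' (matJ a)) G := by
    rcases eq_or_ne a 1 with rfl | ha1
    · exact mem_transvectionSet_one (fun c => eq_zero_or_eq_one_of_mem_closure_one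
        (hgen ▸ Subfield.mem_top c)) hX hY (fun _ => rfl) (fun _ => rfl) hGB
    · exact mem_transvectionSet_of_ne_one ha ha1 hgen hX hY (fun _ => rfl) (fun _ => rfl) hGB
  have : φ g ∈ G := mem_of_transvection_mem (isAlt_toBilin'_matJ a)
    (nondegenerate_toBilin'_matJ a) hG hGB hg
  obtain ⟨h, hh, hhg⟩ := this
  rwa [← φ.injective hhg]

/-- **$(2,3)$-generation of $Sp_6(q)$, $q$ even, by explicit generators.** Let `q` be a
power of `2`, let `F = F_q` and let `a ∈ F` with `a ≠ 0` generate `F_q` over the prime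
field `F_2`. Then the subgroup of `GL_6(F_q)` generated by the explicit matrices `x` and
`y` (of orders `2` and `3`) is exactly the symplectic group of the alternating invertible
matrix `J`: an invertible matrix `g` satisfies `gᵀ * J * g = J` if and only if it lies in
the subgroup generated by `x` and `y`. In particular `Sp_6(q)` is `(2,3)`-generated for
all even `q`. -/
theorem Sp6_eq_closure_of_generator (q : ℕ) (hq : ∃ n : ℕ, 0 < n ∧ q = 2 ^ n)
    (F : Type) [Field F] [Fintype F] (hF : Fintype.card F = q)
    (a : F) (ha : a ≠ 0) (hgen : Subfield.closure {a} = ⊤)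
    (x y J : Matrix (Fin 6) (Fin 6) F)
    (hx : x = !![0,0,1,0,0,0; 0,0,0,1,0,0; 1,0,0,0,0,0; 0,1,0,0,0,0; 0,0,0,0,1,0; 0,0,0,0,a,1])
    (hy : y = !![1,0,0,1,1,0; 0,1,0,0,0,0; 0,0,0,1,0,0; 0,0,1,1,0,0; 0,a,1,1,1,1; 0,a,1,0,1,0])
    (hJ : J = !![0,1,0,0,0,0; 1,0,0,a,a+1,1; 0,0,0,1,0,0; 0,a,1,0,1,1;
      0,a+1,0,1,0,1; 0,1,0,1,1,0]) :
    ∃ X Y : GL (Fin 6) F, (X : Matrix (Fin 6) (Fin 6) F) = x ∧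
      (Y : Matrix (Fin 6) (Fin 6) F) = y ∧ orderOf X = 2 ∧ orderOf Y = 3 ∧
      ∀ g : GL (Fin 6) F,
        (g : Matrix (Fin 6) (Fin 6) F)ᵀ * J * (g : Matrix (Fin 6) (Fin 6) F) = J ↔
          g ∈ Subgroup.closure {X, Y} := by
  obtain ⟨n, -, rfl⟩ := hq
  have : Fact (Nat.Prime 2) := ⟨Nat.prime_two⟩
  have : CharP F 2 := charP_of_card_eq_prime_pow hF
  subst hx hy hJ
  exact ⟨unitX a, unitY a, rfl, rfl, orderOf_unitX a, orderOf_unitY a,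
    transpose_mul_matJ_mul_eq_iff_mem_closure ha hgen⟩
end

section
/- Let F be an algebraically closed field of characteristic 2 and a ∈ F with a ≠ 0, and let x, y be the 6×6 matrices of the dimension-6 setup. Then the group generated by x and y acts irreducibly on F⁶: every linear subspace W of F⁶ with x·W ⊆ W and y·W ⊆ W satisfies W = 0 or W = F⁶. -/
open Matrix

/-- **Absolute irreducibility in dimension 6.** Let `F` be an algebraically closed field
of characteristic `2` and `a ∈ F` with `a ≠ 0`. The group generated by the matrices `x`
and `y` of the dimension-6 setup acts irreducibly on `F⁶`: every subspace invariant under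
`x` and `y` is `0` or all of `F⁶`. -/
theorem dim6_generators_irreducible (F : Type) [Field F] [IsAlgClosed F] [CharP F 2]
    (a : F) (ha : a ≠ 0) (x y : Matrix (Fin 6) (Fin 6) F)
    (hx : x = !![0,0,1,0,0,0; 0,0,0,1,0,0; 1,0,0,0,0,0; 0,1,0,0,0,0; 0,0,0,0,1,0; 0,0,0,0,a,1])
    (hy : y = !![1,0,0,1,1,0; 0,1,0,0,0,0; 0,0,0,1,0,0; 0,0,1,1,0,0; 0,a,1,1,1,1; 0,a,1,0,1,0]) :
    ∀ W : Submodule F (Fin 6 → F),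
      (∀ w ∈ W, x.mulVec w ∈ W) → (∀ w ∈ W, y.mulVec w ∈ W) → W = ⊥ ∨ W = ⊤ := by
  subst hx hy
  intro W hxW hyW
  have h2 : (2 : F) = 0 := CharTwo.two_eq_zero
  have hX : ∀ w ∈ W, ![w 2, w 3, w 0, w 1, w 4, a * w 4 + w 5] ∈ W := fun w hw => by
    convert hxW w hw using 1
    ext i
    fin_cases i <;> simp [Matrix.mulVec, dotProduct, Fin.sum_univ_succ]
  have hY : ∀ w ∈ W, ![w 0 + w 3 + w 4, w 1, w 3, w 2 + w 3, a * w 1 + w 2 + w 3 + w 4 + w 5,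
      a * w 1 + w 2 + w 4] ∈ W := fun w hw => by
    convert hyW w hw using 1
    ext i
    fin_cases i <;> simp [Matrix.mulVec, dotProduct, Fin.sum_univ_succ] <;> grind
  by_cases h : ∀ w ∈ W, w 1 = 0
  · left
    have h3 : ∀ w ∈ W, w 3 = 0 := fun w hw => h _ (hX w hw)
    have h2' : ∀ w ∈ W, w 2 = 0 := fun w hw => by
      have e : w 2 + w 3 = 0 := h3 _ (hY w hw)
      simpa [h3 w hw] using e
    have h0 : ∀ w ∈ W, w 0 = 0 := fun w hw => h2' _ (hX w hw)
    have h4 : ∀ w ∈ W, w 4 = 0 := fun w hw => by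
      have e : w 0 + w 3 + w 4 = 0 := h0 _ (hY w hw)
      simpa [h3 w hw, h0 w hw] using e
    have h5 : ∀ w ∈ W, w 5 = 0 := fun w hw => by
      have e : a * w 1 + w 2 + w 3 + w 4 + w 5 = 0 := h4 _ (hY w hw)
      simpa [h w hw, h2' w hw, h3 w hw, h4 w hw] using e
    rw [Submodule.eq_bot_iff]
    intro w hw
    ext i
    fin_cases i
    exacts [h0 w hw, h w hw, h2' w hw, h3 w hw, h4 w hw, h5 w hw]
  · right
    push Not at h
    obtain ⟨w, hw, hw1⟩ := h
    -- the projection `1 + y + y²` onto the fixed space of `y`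
    have hP : ∀ w ∈ W, ![w 0 + a * w 1 + w 4 + w 5, w 1, 0, 0, 0, a * w 1] ∈ W := fun w hw => by
      convert W.add_mem hw (W.add_mem (hY _ hw) (hY _ (hY _ hw))) using 1
      ext i
      fin_cases i <;> simp <;> grind
    have e0 : ![1, 0, 0, 0, 0, 0] ∈ W := by
      convert W.smul_mem (a * w 1)⁻¹ (hP _ (hX _ (hP _ hw))) using 1
      ext i
      fin_cases i <;> simp
      grind
    have e2 : ![0, 0, 1, 0, 0, 0] ∈ W := by simpa using hX _ e0
    have e345 : ![0, 0, 0, 1, 1, 1] ∈ W := by simpa using hY _ e2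
    have e4 : ![0, 0, 0, 0, 1, 0] ∈ W := by
      convert W.add_mem e0 (W.add_mem (hX _ e345) (hY _ (hX _ e345))) using 1
      ext i
      fin_cases i <;> simp <;> grind
    have e5 : ![0, 0, 0, 0, 0, 1] ∈ W := by
      convert W.smul_mem a⁻¹ (W.sub_mem (hX _ e4) e4) using 1
      ext i
      fin_cases i <;> simp [ha]
    have e3 : ![0, 0, 0, 1, 0, 0] ∈ W := by
      convert W.sub_mem e345 (W.add_mem e4 e5) using 1
      ext i
      fin_cases i <;> simp
    have e1 : ![0, 1, 0, 0, 0, 0] ∈ W := by simpa using hX _ e3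
    rw [Submodule.eq_top_iff']
    intro v
    convert W.add_mem (W.smul_mem (v 0) e0) (W.add_mem (W.smul_mem (v 1) e1)
      (W.add_mem (W.smul_mem (v 2) e2) (W.add_mem (W.smul_mem (v 3) e3)
      (W.add_mem (W.smul_mem (v 4) e4) (W.smul_mem (v 5) e5))))) using 1
    ext i
    fin_cases i <;> simp
end

section
/- Let F be a field of characteristic 2 and a ∈ F with a ≠ 0, and let x, y be the 6×6 matrices of the dimension-6 setup. Then for all units α, β ∈ Fˣ, the characteristic polynomial of x·y, which equals t⁶ + (a+1)t⁵ + t⁴ + t³ + t² + (a+1)t + 1, is different from (t−α)(t−β)(t−αβ)(t−α⁻¹)(t−β⁻¹)(t−(αβ)⁻¹); equivalently, x·y is not conjugate to the diagonal matrix diag(α, β, αβ, α⁻¹, β⁻¹, (αβ)⁻¹) for any α, β. (This is the computational content of the fact that ⟨x,y⟩ is not contained in a subgroup isomorphic to G₂(q), where maximal tori consist of such diagonal elements.) -/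
open Matrix Polynomial

/-- In characteristic `2`, the square of the coefficient of `X ^ 5` equals the coefficient of `X ^ 3`
in the characteristic polynomial of a semisimple element of a maximal torus of `G₂`. -/
lemma sq_coeff_five_eq_coeff_three_G2_torus {F : Type*} [Field F] [CharP F 2] (α β : Fˣ) {p : F[X]}
    (hp : p = (X - C (α : F)) * (X - C (β : F)) * (X - C ((α : F) * (β : F))) *
      (X - C ((α⁻¹ : Fˣ) : F)) * (X - C ((β⁻¹ : Fˣ) : F)) * (X - C (((α * β)⁻¹ : Fˣ) : F))) :
    p.coeff 5 ^ 2 = p.coeff 3 := by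
  have h2 : (2 : F) = 0 := CharTwo.two_eq_zero
  have hC2 : (2 : F[X]) = 0 := CharTwo.two_eq_zero
  have hα : (α : F) * (α⁻¹ : Fˣ) = 1 := α.mul_inv
  have hβ : (β : F) * (β⁻¹ : Fˣ) = 1 := β.mul_inv
  simp only [mul_inv, Units.val_mul] at hp
  generalize (α : F) = r at *
  generalize (β : F) = s at *
  generalize ((α⁻¹ : Fˣ) : F) = r' at *
  generalize ((β⁻¹ : Fˣ) : F) = s' at *
  have pair (u v : F) (huv : u * v = 1) :
      (X - C u) * (X - C v) = X ^ 2 + C (u + v) * X + 1 := by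
    have hC : C u * C v = 1 := by rw [← C_mul, huv, C_1]
    rw [C_add]
    linear_combination hC - (C u + C v) * X * hC2
  have hrs : (r * s) * (r' * s') = 1 := by linear_combination s * s' * hα + hβ
  have hp' : p = (X ^ 2 + C (r + r') * X + 1) * (X ^ 2 + C (s + s') * X + 1) *
      (X ^ 2 + C (r * s + r' * s') * X + 1) := by
    rw [← pair r r' hα, ← pair s s' hβ, ← pair _ _ hrs, hp]
    ring
  generalize hu : r + r' = u at *
  generalize hv : s + s' = v at *
  generalize hw : r * s + r' * s' = w at *
  have hp'' : p = X ^ 6 + C (u + v + w) * X ^ 5 + C (3 + u * v + u * w + v * w) * X ^ 4 +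
      C (2 * (u + v + w) + u * v * w) * X ^ 3 + C (3 + u * v + u * w + v * w) * X ^ 2 +
      C (u + v + w) * X + 1 := by
    rw [hp']
    simp only [C_add, C_mul, C_ofNat]
    ring
  have h5 : p.coeff 5 = u + v + w := by
    rw [hp'']; simp [-map_add, -map_mul, coeff_one]
  have h3 : p.coeff 3 = 2 * (u + v + w) + u * v * w := by
    rw [hp'']; simp [-map_add, -map_mul, coeff_one]
  rw [h5, h3]
  subst hu hv hw
  grind

/-- **`x·y` avoids the `G₂`-tori, dimension 6.** Let `F` be a field of characteristic `2`
and `a ∈ F` with `a ≠ 0`, and let `x, y` be the matrices of the dimension-6 setup. The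
characteristic polynomial of `x·y` equals `t⁶ + (a+1)t⁵ + t⁴ + t³ + t² + (a+1)t + 1` and,
for all units `α, β`, it is different from
`(t−α)(t−β)(t−αβ)(t−α⁻¹)(t−β⁻¹)(t−(αβ)⁻¹)`. -/
theorem dim6_charpoly_ne_G2_torus_charpoly (F : Type) [Field F] [CharP F 2]
    (a : F) (ha : a ≠ 0) (x y : Matrix (Fin 6) (Fin 6) F)
    (hx : x = !![0,0,1,0,0,0; 0,0,0,1,0,0; 1,0,0,0,0,0; 0,1,0,0,0,0; 0,0,0,0,1,0; 0,0,0,0,a,1])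
    (hy : y = !![1,0,0,1,1,0; 0,1,0,0,0,0; 0,0,0,1,0,0; 0,0,1,1,0,0; 0,a,1,1,1,1; 0,a,1,0,1,0]) :
    (x * y).charpoly
        = X ^ 6 + C (a + 1) * X ^ 5 + X ^ 4 + X ^ 3 + X ^ 2 + C (a + 1) * X + 1 ∧
      ∀ α β : Fˣ, (x * y).charpoly ≠
        (X - C (α : F)) * (X - C (β : F)) * (X - C ((α : F) * (β : F))) *
          (X - C ((α⁻¹ : Fˣ) : F)) * (X - C ((β⁻¹ : Fˣ) : F)) *
          (X - C (((α * β)⁻¹ : Fˣ) : F)) := by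
  have hxy : x * y = !![0,0,0,1,0,0; 0,0,1,1,0,0; 1,0,0,1,1,0; 0,1,0,0,0,0; 0,a,1,1,1,1;
      0,a ^ 2 + a,a+1,a,a+1,a] := by
    subst hx hy
    ext i j
    fin_cases i <;> fin_cases j <;> simp [Matrix.mul_apply, Fin.sum_univ_succ]; ring
  have hchar : (x * y).charpoly
      = X ^ 6 + C (a + 1) * X ^ 5 + X ^ 4 + X ^ 3 + X ^ 2 + C (a + 1) * X + 1 := by
    have hmat : (x * y).charmatrix = !![X,0,0,-1,0,0; 0,X,-1,-1,0,0; -1,0,X,-1,-1,0; 0,-1,0,X,0,0;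
        0,-C a,-1,-1,X-1,-1; 0,-(C a ^ 2 + C a),-(C a+1),-C a,-(C a+1),X-C a] := by
      rw [hxy]
      ext1 i j
      fin_cases i <;> fin_cases j <;> simp
    rw [Matrix.charpoly, hmat, Matrix.det_succ_row_zero]
    simp [Fin.sum_univ_succ]
    simp [Matrix.det_succ_row_zero, Fin.sum_univ_succ, Fin.succAbove]
    grind
  refine ⟨hchar, fun α β h => ha ?_⟩
  have h53 := sq_coeff_five_eq_coeff_three_G2_torus α β h
  have h5 : (x * y).charpoly.coeff 5 = a + 1 := by
    rw [hchar]; simp [-map_add, coeff_one]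
  have h3 : (x * y).charpoly.coeff 3 = 1 := by
    rw [hchar]; simp [-map_add, coeff_one]
  rw [h5, h3, CharTwo.add_sq, one_pow, add_eq_right] at h53
  exact pow_eq_zero_iff two_ne_zero |>.mp h53
end

section
/- Let F be an algebraically closed field and a, b ∈ F, and let x, y be the 7×7 matrices of the dimension-7 setup. The group generated by x and y acts irreducibly on F⁷ (every linear subspace W of F⁷ with x·W ⊆ W and y·W ⊆ W is 0 or F⁷) if and only if both Condition (i) and Condition (ii) hold. -/
open Matrix

namespace DimSeven

/-- The involution `x` of the dimension-7 setup. -/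
def genX {R : Type*} [CommRing R] (a : R) : Matrix (Fin 7) (Fin 7) R :=
  !![0,1,0,0,0,0,a; 1,0,0,0,0,0,a; 0,0,0,1,0,0,0; 0,0,1,0,0,0,0;
    0,0,0,0,0,1,-1; 0,0,0,0,1,0,-1; 0,0,0,0,0,0,-1]

/-- The element `y` of order three of the dimension-7 setup. -/
def genY {R : Type*} [CommRing R] (a b : R) : Matrix (Fin 7) (Fin 7) R :=
  !![1,0,-1,0,-1,0,a+b-1; 0,0,-1,0,0,0,0; 0,1,-1,0,0,0,0; 0,0,0,0,-1,0,0;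
    0,0,0,1,-1,0,0; 0,0,0,0,0,0,-1; 0,0,0,0,0,1,-1]

/-- The rows `φ, φx, φxy, φxyx, …`, where `φ` is the linear form such that
`(y² + y + 1) v = φ(v) e₁`. They span the dual module generated by `φ`. -/
def krylov {R : Type*} [CommRing R] (a b : R) : Matrix (Fin 7) (Fin 7) R :=
  !![3, -1, -1, -1, -1, a+b-1, a+b-1;
    -1, 3, -1, -1, a+b-1, -1, -2*b+3;
    -1, -1, -1, a+b-1, -a-b+3, -2*b+3, -a+b-1;
    -1, -1, a+b-1, -1, -2*b+3, -a-b+3, 2*b-5;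
    -1, a+b-1, -a-b+3, -2*b+3, 2*b-1, 2*b-5, -2*b+3;
    a+b-1, -1, -2*b+3, -a-b+3, 2*b-5, 2*b-1, a^2+a*b-2*a-2*b+3;
    a+b-1, -2*b+3, -a+b-1, 2*b-5, -2*b+3, a^2+a*b-2*a-2*b+3, a*b+b^2-2*b-1]

/-- The matrix of `x` on the span of the rows of `krylov a b`. -/
def krylovX {R : Type*} [CommRing R] (a : R) : Matrix (Fin 7) (Fin 7) R :=
  !![0,1,0,0,0,0,0; 1,0,0,0,0,0,0; 0,0,0,1,0,0,0; 0,0,1,0,0,0,0;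
    0,0,0,0,0,1,0; 0,0,0,0,1,0,0; a,a,0,0,-1,-1,-1]

/-- The matrix of `y` on the span of the rows of `krylov a b`. -/
def krylovY {R : Type*} [CommRing R] (a b : R) : Matrix (Fin 7) (Fin 7) R :=
  !![1,0,0,0,0,0,0; 0,0,1,0,0,0,0; -1,-1,-1,0,0,0,0; 0,0,0,0,1,0,0;
    -1,0,0,-1,-1,0,0; 0,0,0,0,0,0,1; a+b-1,0,0,0,0,-1,-1]

section CommRing

variable {R : Type*} [CommRing R] (a b : R)

theorem krylov_mul_genX : krylov a b * genX a = krylovX a * krylov a b := by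
  ext i j
  fin_cases i <;> fin_cases j <;>
    simp [krylov, genX, krylovX, Matrix.mul_apply, Fin.sum_univ_succ] <;> ring

theorem krylov_mul_genY : krylov a b * genY a b = krylovY a b * krylov a b := by
  ext i j
  fin_cases i <;> fin_cases j <;>
    simp [krylov, genY, krylovY, Matrix.mul_apply, Fin.sum_univ_succ] <;> ring

theorem krylov_mulVec_genX (v : Fin 7 → R) :
    krylov a b *ᵥ (genX a *ᵥ v) = krylovX a *ᵥ (krylov a b *ᵥ v) := by
  simp only [mulVec_mulVec, krylov_mul_genX]

theorem krylov_mulVec_genY (v : Fin 7 → R) :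
    krylov a b *ᵥ (genY a b *ᵥ v) = krylovY a b *ᵥ (krylov a b *ᵥ v) := by
  simp only [mulVec_mulVec, krylov_mul_genY]

/-- A matrix equivalent to `krylov a b`, in which `x` has been partially diagonalised. -/
def krylovReduced : Matrix (Fin 7) (Fin 7) R :=
  !![4, 0, -a-b, a+3*b-4, 0, 0, 0;
    0, -a-b, -a+b, -a-b+4, 0, 0, 0;
    -a-b, -a+b, 4, -a^2-a*b+2*a, 0, 0, 0;
    -1, -1, a+b-1, -2*b+3, 2, -2, a+b-2;
    -1, a+b-1, -2*b+3, 2*b-5, -2, a+b-2, -a-3*b+6;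
    a+b-1, -2*b+3, 2*b-5, a^2+a*b-2*a-2*b+3, a+b-2, -a-3*b+6, 4*b-6;
    a+b-1, -a+b-1, -2*b+3, a*b+b^2-2*b-1, a-b+2, -a+3*b-6, a^2+a*b-2*a-4*b+6]

set_option maxHeartbeats 2000000 in
theorem det_krylovReduced : (krylovReduced a b).det =
    (a ^ 2 - a * b + b ^ 2 + 2 * a + 2 * b + 4) *
      ((a + b) ^ 3 - 8 * (a + b - 2) ^ 2 - 8 * (a * b)) ^ 2 := by
  simp [krylovReduced, det_succ_row_zero, Fin.sum_univ_succ, Fin.succAbove, -neg_add_rev]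
  ring

/-- The row operations leading from `krylov a b` to `krylovReduced a b`. -/
def rowOps : Matrix (Fin 7) (Fin 7) R :=
  !![1,-1,0,0,0,0,0; 0,0,1,-1,0,0,0; 0,0,0,0,1,-1,0; 0,1,0,0,0,0,0;
    0,0,0,1,0,0,0; 0,0,0,0,0,1,0; 0,0,0,0,0,0,1]

/-- The column operations leading from `krylovReduced a b` back to `krylov a b`. -/
def colOps : Matrix (Fin 7) (Fin 7) R :=
  !![1,-1,0,0,0,0,0; 0,0,1,-1,0,0,0; 0,0,0,0,1,-1,0; 0,0,0,0,0,0,1;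
    0,1,0,0,0,0,0; 0,0,0,1,0,0,0; 0,0,0,0,0,1,0]

theorem rowOps_mul_krylov : rowOps * krylov a b = krylovReduced a b * colOps := by
  ext i j
  fin_cases i <;> fin_cases j <;>
    simp [krylov, rowOps, colOps, krylovReduced, Matrix.mul_apply, Fin.sum_univ_succ] <;> ring

theorem det_rowOps : (rowOps : Matrix (Fin 7) (Fin 7) R).det = -1 := by
  simp [rowOps, det_succ_row_zero, Fin.sum_univ_succ, Fin.succAbove]

theorem det_colOps : (colOps : Matrix (Fin 7) (Fin 7) R).det = 1 := by
  simp [colOps, det_succ_row_zero, Fin.sum_univ_succ, Fin.succAbove]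
  ring

theorem det_krylov : (krylov a b).det =
    -((a ^ 2 - a * b + b ^ 2 + 2 * a + 2 * b + 4) *
      ((a + b) ^ 3 - 8 * (a + b - 2) ^ 2 - 8 * (a * b)) ^ 2) := by
  have h := congrArg det (rowOps_mul_krylov a b)
  rw [det_mul, det_mul, det_rowOps, det_colOps, det_krylovReduced] at h
  linear_combination -h

theorem genY_mulVec (v : Fin 7 → R) : genY a b *ᵥ v =
    ![v 0 - v 2 - v 4 + (a + b - 1) * v 6, -v 2, v 1 - v 2, -v 4, v 3 - v 4, -v 6,
      v 5 - v 6] := by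
  ext i
  fin_cases i <;> simp [genY, mulVec, dotProduct, Fin.sum_univ_succ] <;> ring

theorem genY_cyclotomic (v : Fin 7 → R) :
    genY a b *ᵥ (genY a b *ᵥ v) + genY a b *ᵥ v + v =
      (krylov a b *ᵥ v) 0 • Pi.single 0 1 := by
  ext i
  fin_cases i <;>
    simp [genY_mulVec, krylov, mulVec, dotProduct, Fin.sum_univ_succ] <;> ring

variable {a b} {W : Submodule R (Fin 7 → R)}

/-- The first basis vector generates the whole module. -/
theorem eq_top_of_single_zero_mem (hX : ∀ w ∈ W, genX a *ᵥ w ∈ W)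
    (hY : ∀ w ∈ W, genY a b *ᵥ w ∈ W) (h0 : Pi.single 0 1 ∈ W) : W = ⊤ := by
  have hXs (i j : Fin 7) (hij : (genX a).col i = Pi.single j 1)
      (h : Pi.single i 1 ∈ W) : Pi.single j 1 ∈ W := by
    simpa [hij] using hX _ h
  have hYs (i j : Fin 7) (hij : (genY a b).col i = Pi.single j 1)
      (h : Pi.single i 1 ∈ W) : Pi.single j 1 ∈ W := by
    simpa [hij] using hY _ h
  have h1 := hXs 0 1 (by ext i; fin_cases i <;> simp [genX]) h0
  have h2 := hYs 1 2 (by ext i; fin_cases i <;> simp [genY]) h1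
  have h3 := hXs 2 3 (by ext i; fin_cases i <;> simp [genX]) h2
  have h4 := hYs 3 4 (by ext i; fin_cases i <;> simp [genY]) h3
  have h5 := hXs 4 5 (by ext i; fin_cases i <;> simp [genX]) h4
  have h6 := hYs 5 6 (by ext i; fin_cases i <;> simp [genY]) h5
  refine Submodule.eq_top_iff'.2 fun w => ?_
  rw [pi_eq_sum_univ' w]
  refine W.sum_mem fun i _ => W.smul_mem _ ?_
  fin_cases i <;> assumption

/-- An invariant submodule on which `φ` vanishes is killed by all of `krylov a b`. -/
theorem krylov_mulVec_eq_zero (hX : ∀ w ∈ W, genX a *ᵥ w ∈ W)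
    (hY : ∀ w ∈ W, genY a b *ᵥ w ∈ W) (h0 : ∀ w ∈ W, (krylov a b *ᵥ w) 0 = 0)
    {w : Fin 7 → R} (hw : w ∈ W) : krylov a b *ᵥ w = 0 := by
  have hXs (i j : Fin 7) (hij : krylovX a i = Pi.single j 1)
      (h : ∀ w ∈ W, (krylov a b *ᵥ w) i = 0) : ∀ w ∈ W, (krylov a b *ᵥ w) j = 0 := by
    intro w hw
    have := h _ (hX w hw)
    rwa [krylov_mulVec_genX, mulVec, hij, single_one_dotProduct] at this
  have hYs (i j : Fin 7) (hij : krylovY a b i = Pi.single j 1)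
      (h : ∀ w ∈ W, (krylov a b *ᵥ w) i = 0) : ∀ w ∈ W, (krylov a b *ᵥ w) j = 0 := by
    intro w hw
    have := h _ (hY w hw)
    rwa [krylov_mulVec_genY, mulVec, hij, single_one_dotProduct] at this
  have h1 := hXs 0 1 (by ext i; fin_cases i <;> simp [krylovX]) h0
  have h2 := hYs 1 2 (by ext i; fin_cases i <;> simp [krylovY]) h1
  have h3 := hXs 2 3 (by ext i; fin_cases i <;> simp [krylovX]) h2
  have h4 := hYs 3 4 (by ext i; fin_cases i <;> simp [krylovY]) h3
  have h5 := hXs 4 5 (by ext i; fin_cases i <;> simp [krylovX]) h4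
  have h6 := hYs 5 6 (by ext i; fin_cases i <;> simp [krylovY]) h5
  ext i
  fin_cases i
  exacts [h0 w hw, h1 w hw, h2 w hw, h3 w hw, h4 w hw, h5 w hw, h6 w hw]

end CommRing

theorem irreducible_iff_det_krylov_ne_zero {F : Type*} [Field F] (a b : F) :
    (∀ W : Submodule F (Fin 7 → F), (∀ w ∈ W, genX a *ᵥ w ∈ W) →
      (∀ w ∈ W, genY a b *ᵥ w ∈ W) → W = ⊥ ∨ W = ⊤) ↔ (krylov a b).det ≠ 0 := by
  constructor
  · intro h hdet
    obtain ⟨v, hv, hKv⟩ := exists_mulVec_eq_zero_iff.2 hdet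
    rcases h (LinearMap.ker (krylov a b).mulVecLin)
      (fun w hw => by
        rw [LinearMap.mem_ker, mulVecLin_apply] at hw ⊢
        rw [krylov_mulVec_genX, hw, mulVec_zero])
      (fun w hw => by
        rw [LinearMap.mem_ker, mulVecLin_apply] at hw ⊢
        rw [krylov_mulVec_genY, hw, mulVec_zero]) with hW | hW
    · exact hv ((Submodule.eq_bot_iff _).1 hW v hKv)
    · have := congrFun (Submodule.eq_top_iff'.1 hW (Pi.single 1 1) : krylov a b *ᵥ _ = 0) 0
      simp [krylov] at this
  · intro hdet W hX hY
    by_cases h0 : ∀ w ∈ W, (krylov a b *ᵥ w) 0 = 0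
    · exact .inl <| (Submodule.eq_bot_iff _).2 fun w hw =>
        eq_zero_of_mulVec_eq_zero hdet (krylov_mulVec_eq_zero hX hY h0 hw)
    · push Not at h0
      obtain ⟨w, hw, hne⟩ := h0
      refine .inr (eq_top_of_single_zero_mem hX hY ((W.smul_mem_iff hne).1 ?_))
      rw [← genY_cyclotomic]
      exact W.add_mem (W.add_mem (hY _ (hY _ hw)) (hY _ hw)) hw

end DimSeven

/-- **Criterion for absolute irreducibility in dimension 7.** Let `F` be an algebraically
closed field and `a, b ∈ F`, and let `x, y` be the matrices of the dimension-7 setup.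
The group generated by `x` and `y` acts irreducibly on `F⁷` if and only if both
`a² − ab + b² + 2a + 2b + 4 ≠ 0` and `(a+b)³ − 8(a+b−2)² − 8ab ≠ 0`. -/
theorem dim7_generators_irreducible_iff (F : Type) [Field F] [IsAlgClosed F]
    (a b : F) (x y : Matrix (Fin 7) (Fin 7) F)
    (hx : x = !![0,1,0,0,0,0,a; 1,0,0,0,0,0,a; 0,0,0,1,0,0,0; 0,0,1,0,0,0,0;
      0,0,0,0,0,1,-1; 0,0,0,0,1,0,-1; 0,0,0,0,0,0,-1])
    (hy : y = !![1,0,-1,0,-1,0,a+b-1; 0,0,-1,0,0,0,0; 0,1,-1,0,0,0,0; 0,0,0,0,-1,0,0;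
      0,0,0,1,-1,0,0; 0,0,0,0,0,0,-1; 0,0,0,0,0,1,-1]) :
    (∀ W : Submodule F (Fin 7 → F),
        (∀ w ∈ W, x.mulVec w ∈ W) → (∀ w ∈ W, y.mulVec w ∈ W) → W = ⊥ ∨ W = ⊤) ↔
      (a ^ 2 - a * b + b ^ 2 + 2 * a + 2 * b + 4 ≠ 0 ∧
        (a + b) ^ 3 - 8 * (a + b - 2) ^ 2 - 8 * (a * b) ≠ 0) := by
  subst hx hy
  refine (DimSeven.irreducible_iff_det_krylov_ne_zero a b).trans ?_
  simp [DimSeven.det_krylov]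
end

section
/- Let F be a field and a, b ∈ F satisfying Condition (i) and Condition (ii), and let x, y be the 7×7 matrices of the dimension-7 setup. Then the minimal polynomial of x·y equals its characteristic polynomial, namely t⁷ − t⁵ + (1−a)t⁴ + (b−1)t³ + t² − 1. -/
open Matrix Polynomial

/-- If the row vectors `r, r z, …, r zⁿ⁻¹` are linearly independent, then every monic polynomial
`q` of degree `n` with `r q(z) = 0` is both the minimal and the characteristic polynomial of the
`n × n` matrix `z`. -/
theorem minpoly_and_charpoly_eq_of_linearIndependent {F : Type*} [Field F] {n : ℕ}
    {z : Matrix (Fin n) (Fin n) F} (r : Fin n → F)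
    (hr : LinearIndependent F fun i : Fin n => r ᵥ* z ^ (i : ℕ))
    {q : F[X]} (hq : q.Monic) (hdeg : q.natDegree = n) (hrq : r ᵥ* aeval z q = 0) :
    minpoly F z = q ∧ z.charpoly = q := by
  have hz : aeval z q = 0 := by
    have hunit := linearIndependent_rows_iff_isUnit (A := of fun i : Fin n => r ᵥ* z ^ (i : ℕ)).mp hr
    refine hunit.mul_right_eq_zero.mp (Matrix.ext_row fun i => ?_)
    change (r ᵥ* z ^ (i : ℕ)) ᵥ* aeval z q = 0
    have hcomm : Commute (z ^ (i : ℕ)) (aeval z q) := by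
      simpa using Commute.map (Commute.all (X ^ (i : ℕ)) q) (aeval z)
    rw [vecMul_vecMul, hcomm.eq, ← vecMul_vecMul, hrq, zero_vecMul]
  have hint : IsIntegral F z := ⟨q, hq, hz⟩
  have hle : n ≤ (minpoly F z).natDegree := by
    by_contra! hlt
    have h0 : r ᵥ* aeval z (minpoly F z) = 0 := by rw [minpoly.aeval, vecMul_zero]
    rw [aeval_eq_sum_range' hlt, Finset.sum_range, vecMul_sum] at h0
    simp only [vecMul_smul] at h0
    have hc := Fintype.linearIndependent_iff.mp hr _ h0
    exact (minpoly.monic hint).leadingCoeff ▸ one_ne_zero <| hc ⟨_, hlt⟩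
  have key {p : F[X]} (hp : p.Monic) (hpn : p.natDegree = n) (hpz : aeval z p = 0) :
      minpoly F z = p :=
    (eq_of_monic_of_dvd_of_natDegree_le (minpoly.monic hint) hp (minpoly.dvd F z hpz)
      (hpn.trans_le hle)).symm
  have h := key hq hdeg hz
  refine ⟨h, ?_⟩
  rw [← h, key (charpoly_monic z) (by simp) (aeval_self_charpoly z)]

/-- The action of the product `x·y` of the dimension-7 setup on row vectors. -/
theorem vecMul_dim7_mul {F : Type*} [Field F] (a b : F) (v : Fin 7 → F) :
    v ᵥ* (!![0,1,0,0,0,0,a; 1,0,0,0,0,0,a; 0,0,0,1,0,0,0; 0,0,1,0,0,0,0;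
      0,0,0,0,0,1,-1; 0,0,0,0,1,0,-1; 0,0,0,0,0,0,-1] *
      !![1,0,-1,0,-1,0,a+b-1; 0,0,-1,0,0,0,0; 0,1,-1,0,0,0,0; 0,0,0,0,-1,0,0;
      0,0,0,1,-1,0,0; 0,0,0,0,0,0,-1; 0,0,0,0,0,1,-1] : Matrix (Fin 7) (Fin 7) F) =
      ![v 1, v 3, -v 0 - v 1 - v 3, v 5, -v 1 - v 2 - v 5,
        a * v 0 + a * v 1 - v 4 - v 5 - v 6, -a * v 0 + (b - 1) * v 1 + v 5 + v 6] := by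
  rw [← vecMul_vecMul]
  ext j
  fin_cases j <;> simp [vecMul, dotProduct, Fin.sum_univ_succ] <;> ring

/-- **The minimal polynomial of `z = x·y` in dimension 7.** Let `F` be a field and
`a, b ∈ F` satisfying Conditions (i) and (ii), and let `x, y` be the matrices of the
dimension-7 setup. Then the minimal polynomial of `x·y` coincides with its characteristic
polynomial, namely `t⁷ − t⁵ + (1−a)t⁴ + (b−1)t³ + t² − 1`. -/
theorem dim7_minpoly_eq_charpoly (F : Type) [Field F] (a b : F)
    (hi : a ^ 2 - a * b + b ^ 2 + 2 * a + 2 * b + 4 ≠ 0)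
    (hii : (a + b) ^ 3 - 8 * (a + b - 2) ^ 2 - 8 * (a * b) ≠ 0)
    (x y : Matrix (Fin 7) (Fin 7) F)
    (hx : x = !![0,1,0,0,0,0,a; 1,0,0,0,0,0,a; 0,0,0,1,0,0,0; 0,0,1,0,0,0,0;
      0,0,0,0,0,1,-1; 0,0,0,0,1,0,-1; 0,0,0,0,0,0,-1])
    (hy : y = !![1,0,-1,0,-1,0,a+b-1; 0,0,-1,0,0,0,0; 0,1,-1,0,0,0,0; 0,0,0,0,-1,0,0;
      0,0,0,1,-1,0,0; 0,0,0,0,0,0,-1; 0,0,0,0,0,1,-1]) :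
    (x * y).charpoly
        = X ^ 7 - X ^ 5 + C (1 - a) * X ^ 4 + C (b - 1) * X ^ 3 + X ^ 2 - 1 ∧
      minpoly F (x * y) = (x * y).charpoly := by
  have step (v : Fin 7 → F) : v ᵥ* (x * y) = ![v 1, v 3, -v 0 - v 1 - v 3, v 5, -v 1 - v 2 - v 5,
      a * v 0 + a * v 1 - v 4 - v 5 - v 6, -a * v 0 + (b - 1) * v 1 + v 5 + v 6] := by
    rw [hx, hy, vecMul_dim7_mul]
  generalize x * y = z at step ⊢
  set r : Fin 7 → F := ![0,0,1,0,-1,0,1] with hr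
  have hpow (k : ℕ) : r ᵥ* z ^ (k + 1) = (r ᵥ* z ^ k) ᵥ* z := by
    rw [pow_succ, vecMul_vecMul]
  have h0 : r ᵥ* z ^ 0 = r := by simp
  have h1 : r ᵥ* z ^ 1 = ![0,0,0,0,-1,0,1] := by
    rw [hpow, h0, step]; simp [hr]
  have h2 : r ᵥ* z ^ 2 = ![0,0,0,0,0,0,1] := by
    rw [hpow, h1, step]; simp
  have h3 : r ᵥ* z ^ 3 = ![0,0,0,0,0,-1,1] := by
    rw [hpow, h2, step]; simp
  have h4 : r ᵥ* z ^ 4 = ![0,0,0,-1,1,0,0] := by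
    rw [hpow, h3, step]; simp
  have h5 : r ᵥ* z ^ 5 = ![0,-1,1,0,0,-1,0] := by
    rw [hpow, h4, step]; simp
  have h6 : r ᵥ* z ^ 6 = ![-1,0,1,-1,1,1-a,-b] := by
    rw [hpow, h5, step]; simp; constructor <;> ring
  have h7 : r ᵥ* z ^ 7 = ![0,-1,2,1-a,a-2,b-2,1-b] := by
    rw [hpow, h6, step]; ext j; fin_cases j <;> simp <;> ring
  have hind : LinearIndependent F fun i : Fin 7 => r ᵥ* z ^ (i : ℕ) := by
    rw [Fintype.linearIndependent_iff]
    intro c hc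
    have e (j : Fin 7) := congrFun hc j
    simp only [Fin.sum_univ_seven, Fin.coe_ofNat_eq_mod, Nat.reduceMod, h0, h1, h2, h3, h4, h5, h6]
      at e
    have e0 := e 0
    have e1 := e 1
    have e2 := e 2
    have e3 := e 3
    have e4 := e 4
    have e5 := e 5
    have e6 := e 6
    simp [hr] at e0 e1 e2 e3 e4 e5 e6
    intro i
    fin_cases i <;> grind
  have hdeg : (X ^ 7 - X ^ 5 + C (1 - a) * X ^ 4 + C (b - 1) * X ^ 3 + X ^ 2 - 1 : F[X]).natDegree
      = 7 := by compute_degree!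
  have hmonic : (X ^ 7 - X ^ 5 + C (1 - a) * X ^ 4 + C (b - 1) * X ^ 3 + X ^ 2 - 1 : F[X]).Monic := by
    monicity!
  have hzero : r ᵥ* aeval z
      (X ^ 7 - X ^ 5 + C (1 - a) * X ^ 4 + C (b - 1) * X ^ 3 + X ^ 2 - 1 : F[X]) = 0 := by
    rw [← smul_eq_C_mul, ← smul_eq_C_mul]
    simp only [map_sub, map_add, map_smul, map_pow, aeval_X, map_one, vecMul_sub,
      vecMul_add, vecMul_smul, vecMul_one, h2, h3, h4, h5, h7]
    ext j
    fin_cases j <;> simp [hr] <;> ring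
  obtain ⟨hmin, hchar⟩ := minpoly_and_charpoly_eq_of_linearIndependent r hind hmonic hdeg hzero
  exact ⟨hchar, hmin.trans hchar.symm⟩
end

section
/- Let q be a prime power, F = F_{q²}, σ : F → F the automorphism α ↦ α^q, and a ∈ F; set b = a^q and suppose a, b satisfy Condition (i) and Condition (ii). Let x, y be the 7×7 matrices of the dimension-7 setup over F. Then there exists an invertible Hermitian 7×7 matrix J over F (Jᵀ = J.map σ, det J ≠ 0) with xᵀ · J · (x.map σ) = J and yᵀ · J · (y.map σ) = J; that is, the group generated by x and y is contained in a unitary group SU_7(q²). -/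
open Matrix

/-- The matrix of the sesquilinear form preserved by the two generators, where `b` stands for the
conjugate of `a`. -/
def dim7Form {R : Type*} [CommRing R] (a b : R) : Matrix (Fin 7) (Fin 7) R :=
  !![3, -1, -1, -1, -1, a + b - 1, a + b - 1;
    -1, 3, -1, -1, a + b - 1, -1, 3 - 2 * a;
    -1, -1, 3, 3 - a - b, -1, a - b - 1, -1;
    -1, -1, 3 - a - b, 3, a - b - 1, -1, 3 - a - b;
    -1, a + b - 1, -1, b - a - 1, 3, -1, -1;
    a + b - 1, -1, b - a - 1, -1, -1, 3, b * (a + b - 2) - 1;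
    a + b - 1, 3 - 2 * b, -1, 3 - a - b, -1, a * (a + b - 2) - 1, 3]

/-- The adjugate of `dim7Form a b` divided by `(a + b) ^ 3 - 8 * (a + b - 2) ^ 2 - 8 * (a * b)`. -/
def dim7FormReducedAdjugate {R : Type*} [CommRing R] (a b : R) : Matrix (Fin 7) (Fin 7) R :=
  let s := a + b
  let p := a * b
  let u : R := 16 - 8 * s + 3 * s ^ 2
  let v : R := 16 * s - 12 * p + s ^ 2
  let w : R := 16 * s - 16 * p + 4 * s ^ 2 - s ^ 3
  let t : R := 32 - 8 * s - 8 * p + 6 * s * p - s ^ 3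
  let g : R := 16 * p - 12 * s * p + 3 * s ^ 3 + 3 * s ^ 2 * p - s ^ 4
  let d : R := w - 8 * s ^ 2 - 8 * s * p + 6 * s ^ 3 + 8 * p ^ 2 - 4 * s ^ 2 * p + s ^ 4 - s ^ 3 * p
  let k (z : R) : R := 32 + 8 * s - 16 * p - 2 * s ^ 2 + 6 * s * p - z * u
  let l (z : R) : R := 32 - 16 * p + 10 * s ^ 2 - s ^ 3 - z * v
  let m (z : R) : R := 16 * s - 8 * p - 2 * s ^ 2 + s ^ 3 - z * u
  let n (z : R) : R := 8 * s - 8 * p + 10 * s ^ 2 - 6 * s * p - z * v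
  let e (z : R) : R := -8 * s - 8 * p + 6 * s ^ 2 + 6 * s * p - 2 * s ^ 3 - 3 * s ^ 2 * p + s ^ 4 +
    z * (32 - 8 * s - 12 * p + 3 * s ^ 2 + 6 * s * p - 2 * s ^ 3)
  let c₁ (z : R) : R := 32 - 8 * s - 24 * p + 12 * s ^ 2 + 6 * s * p - 5 * s ^ 3 +
    z * (-8 * s + 8 * p + 6 * s ^ 2 - 6 * s * p + s ^ 3)
  let c₂ (z : R) : R := 32 - 24 * s - 16 * p + 6 * s ^ 2 + 14 * s * p - 6 * s ^ 2 * p + s ^ 4 +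
    z * (16 - 8 * p - 3 * s ^ 2 + 6 * s * p - s ^ 3)
  let c₄ (z : R) : R := 32 - 32 * p + 10 * s ^ 2 + 16 * s * p - 7 * s ^ 3 - 3 * s ^ 2 * p +
    2 * s ^ 4 + z * (-16 * s + 4 * p + 5 * s ^ 2 - 2 * s ^ 3)
  let c₅ (z : R) : R := 32 + 16 * s - 24 * p - 8 * s ^ 2 + 12 * s * p - s ^ 3 +
    z * (-16 + 8 * s + 4 * p - 6 * s ^ 2 + s ^ 3)
  let c₆ (z : R) : R := 8 * s - 8 * p - 6 * s ^ 2 + 10 * s * p - 4 * s ^ 3 + s ^ 4 +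
    z * (-4 * p + 3 * s ^ 2 - s ^ 3)
  !![d, c₁ a, c₂ a, c₆ a + w + g, c₄ a, c₅ a, c₆ a;
    c₁ b, w, e a, k a, k a - g, t, -n a;
    c₂ b, e b, w, g, k a, l a, t;
    c₆ b + w + g, k b, g, w, n a, m a, -t;
    c₄ b, k b - g, k b, n b, w, k a, m a;
    c₅ b, t, l b, m b, k b, w, m b;
    c₆ b, -n b, t, -t, m b, m a, w]

set_option maxHeartbeats 2000000 in
theorem dim7Form_mul_reducedAdjugate {R : Type*} [CommRing R] (a b : R) :
    dim7Form a b * dim7FormReducedAdjugate a b =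
      ((a ^ 2 - a * b + b ^ 2 + 2 * a + 2 * b + 4) *
        ((a + b) ^ 3 - 8 * (a + b - 2) ^ 2 - 8 * (a * b))) • 1 := by
  ext i j
  fin_cases i <;> fin_cases j <;>
    simp [dim7Form, dim7FormReducedAdjugate, Matrix.mul_apply, Fin.sum_univ_succ] <;> ring

theorem dim7Form_transpose {R : Type*} [CommRing R] (a b : R) :
    (dim7Form a b)ᵀ = dim7Form b a := by
  ext i j
  fin_cases i <;> fin_cases j <;> simp [dim7Form] <;> ring

theorem dim7Form_map {R S : Type*} [CommRing R] [CommRing S] (f : R →+* S) (a b : R) :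
    (dim7Form a b).map f = dim7Form (f a) (f b) := by
  ext i j
  fin_cases i <;> fin_cases j <;> simp [dim7Form, map_ofNat f]

theorem dim7Form_det_ne_zero {F : Type*} [Field F] {a b : F}
    (hi : a ^ 2 - a * b + b ^ 2 + 2 * a + 2 * b + 4 ≠ 0)
    (hii : (a + b) ^ 3 - 8 * (a + b - 2) ^ 2 - 8 * (a * b) ≠ 0) :
    (dim7Form a b).det ≠ 0 := by
  intro h
  have := congrArg Matrix.det (dim7Form_mul_reducedAdjugate a b)
  rw [det_mul, h, zero_mul, det_smul, det_one, mul_one] at this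
  exact pow_ne_zero _ (mul_ne_zero hi hii) this.symm

set_option maxHeartbeats 400000 in
theorem dim7Form_invariant_involution {R : Type*} [CommRing R] (a b : R) :
    (!![0,1,0,0,0,0,a; 1,0,0,0,0,0,a; 0,0,0,1,0,0,0; 0,0,1,0,0,0,0;
      0,0,0,0,0,1,-1; 0,0,0,0,1,0,-1; 0,0,0,0,0,0,-1] :
      Matrix (Fin 7) (Fin 7) R)ᵀ * dim7Form a b *
      !![0,1,0,0,0,0,b; 1,0,0,0,0,0,b; 0,0,0,1,0,0,0; 0,0,1,0,0,0,0;
      0,0,0,0,0,1,-1; 0,0,0,0,1,0,-1; 0,0,0,0,0,0,-1] = dim7Form a b := by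
  ext i j
  fin_cases i <;> fin_cases j <;>
    simp [dim7Form, Matrix.mul_apply, Fin.sum_univ_succ] <;> ring

set_option maxHeartbeats 400000 in
theorem dim7Form_invariant_order_three {R : Type*} [CommRing R] (a b : R) :
    (!![1,0,-1,0,-1,0,a + b - 1; 0,0,-1,0,0,0,0; 0,1,-1,0,0,0,0;
      0,0,0,0,-1,0,0; 0,0,0,1,-1,0,0; 0,0,0,0,0,0,-1; 0,0,0,0,0,1,-1] :
      Matrix (Fin 7) (Fin 7) R)ᵀ * dim7Form a b *
      !![1,0,-1,0,-1,0,a + b - 1; 0,0,-1,0,0,0,0; 0,1,-1,0,0,0,0;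
      0,0,0,0,-1,0,0; 0,0,0,1,-1,0,0; 0,0,0,0,0,0,-1; 0,0,0,0,0,1,-1] = dim7Form a b := by
  ext i j
  fin_cases i <;> fin_cases j <;>
    simp [dim7Form, Matrix.mul_apply, Fin.sum_univ_succ] <;> ring

/-- **`⟨x,y⟩ ≤ SU_7(q²)`.** Let `q` be a prime power, `F = F_{q²}`, `σ : α ↦ α^q`, and
`a ∈ F`, with `b = a^q = σ a` satisfying Conditions (i) and (ii). Then the matrices
`x, y` of the dimension-7 setup preserve a nondegenerate Hermitian form: there is an
invertible matrix `J` with `Jᵀ = J^σ`, `xᵀ J x^σ = J` and `yᵀ J y^σ = J`. -/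
theorem dim7_unitary_invariant_form (q : ℕ) (hq : IsPrimePow q)
    (F : Type) [Field F] [Fintype F] (hF : Fintype.card F = q ^ 2)
    (σ : F →+* F) (hσ : ∀ α : F, σ α = α ^ q) (a : F)
    (hi : a ^ 2 - a * σ a + (σ a) ^ 2 + 2 * a + 2 * σ a + 4 ≠ 0)
    (hii : (a + σ a) ^ 3 - 8 * (a + σ a - 2) ^ 2 - 8 * (a * σ a) ≠ 0)
    (x y : Matrix (Fin 7) (Fin 7) F)
    (hx : x = !![0,1,0,0,0,0,a; 1,0,0,0,0,0,a; 0,0,0,1,0,0,0; 0,0,1,0,0,0,0;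
      0,0,0,0,0,1,-1; 0,0,0,0,1,0,-1; 0,0,0,0,0,0,-1])
    (hy : y = !![1,0,-1,0,-1,0,a + σ a - 1; 0,0,-1,0,0,0,0; 0,1,-1,0,0,0,0;
      0,0,0,0,-1,0,0; 0,0,0,1,-1,0,0; 0,0,0,0,0,0,-1; 0,0,0,0,0,1,-1]) :
    ∃ J : Matrix (Fin 7) (Fin 7) F, Jᵀ = J.map σ ∧ J.det ≠ 0 ∧
      xᵀ * J * x.map σ = J ∧ yᵀ * J * y.map σ = J := by
  have hσσ : σ (σ a) = a := by
    rw [hσ, hσ, ← pow_mul, ← sq, ← hF, FiniteField.pow_card]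
  refine ⟨dim7Form a (σ a), ?_, dim7Form_det_ne_zero hi hii, ?_, ?_⟩
  · rw [dim7Form_transpose, dim7Form_map, hσσ]
  · subst hx
    convert dim7Form_invariant_involution a (σ a) using 2
    ext i j
    fin_cases i <;> fin_cases j <;> simp
  · subst hy
    convert dim7Form_invariant_order_three a (σ a) using 2
    ext i j
    fin_cases i <;> fin_cases j <;> simp [hσσ, add_comm]
end

section
/- Let F = F_4 be the field with 4 elements and ω ∈ F with ω² + ω + 1 = 0, and let σ : F → F be the automorphism α ↦ α². Let x and y be the 7×7 matrices over F given by x = [[0,1,0,0,0,0,0],[1,0,0,0,0,0,0],[0,0,1,0,0,0,0],[0,0,0,1,1,0,ω],[0,0,0,1,0,ω²,ω],[0,0,0,0,ω,1,ω²],[0,0,0,ω²,ω²,ω,0]] and y = [[1,0,0,0,0,0,0],[0,0,0,1,0,0,0],[0,1,0,0,0,0,0],[0,0,1,0,0,0,0],[0,0,0,0,0,0,1],[0,0,0,0,1,0,0],[0,0,0,0,0,1,0]]. Then x² = y³ = I, x and y satisfy xᵀ·(x.map σ) = I = yᵀ·(y.map σ) and have determinant 1, and the subgroup they generate equals SU_7(4):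 an invertible 7×7 matrix g over F satisfies det g = 1 and gᵀ·(g.map σ) = I if and only if g lies in the subgroup generated by x and y. In particular SU_7(4) is (2,3)-generated. -/
open Matrix

section Transvections

variable {ι F : Type*} [Fintype ι] [DecidableEq ι] [Field F]

/-- The unitary transvection `w ↦ w + h(w, v) v` over the field with four elements, where
`h(w, v) = ∑ i, w i * v i ^ 2`. -/
def unitaryTransvection (v : ι → F) : Matrix ι ι F :=
  1 + vecMulVec v (v ^ 2)

lemma unitaryTransvection_mulVec (u v : ι → F) :
    unitaryTransvection u *ᵥ v = v + (v ⬝ᵥ u ^ 2) • u := by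
  rw [unitaryTransvection, add_mulVec, one_mulVec, vecMulVec_mulVec, dotProduct_comm]
  simp

/-- The subgroup `H` contains the unitary transvection with direction `v`. -/
def HasTransvection (H : Subgroup (GL ι F)) (v : ι → F) : Prop :=
  ∃ g ∈ H, (g : Matrix ι ι F) = unitaryTransvection v

lemma mul_unitaryTransvection {σ : F →+* F} (hσ : ∀ a, σ a = a ^ 2) {g : Matrix ι ι F}
    (hg : gᵀ * g.map σ = 1) (v : ι → F) :
    g * unitaryTransvection v = unitaryTransvection (g *ᵥ v) * g := by
  have key : (g *ᵥ v) ^ 2 ᵥ* g = v ^ 2 := by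
    have h1 : (g *ᵥ v) ^ 2 = g.map σ *ᵥ (σ ∘ v) := by
      ext i
      rw [Pi.pow_apply, ← hσ, RingHom.map_mulVec]
    have h2 : σ ∘ v = v ^ 2 := by
      ext i
      simp [hσ]
    rw [h1, ← mulVec_transpose, mulVec_mulVec, hg, one_mulVec, h2]
  rw [unitaryTransvection, unitaryTransvection, mul_add, add_mul, mul_one, one_mul,
    mul_vecMulVec, vecMulVec_mul, key]

lemma HasTransvection.mulVec {σ : F →+* F} (hσ : ∀ a, σ a = a ^ 2) {H : Subgroup (GL ι F)}
    {g : GL ι F} (hg : g ∈ H) (hgu : (g : Matrix ι ι F)ᵀ * (g : Matrix ι ι F).map σ = 1)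
    {v : ι → F} (hv : HasTransvection H v) :
    HasTransvection H ((g : Matrix ι ι F) *ᵥ v) := by
  obtain ⟨t, ht, htv⟩ := hv
  refine ⟨g * t * g⁻¹, H.mul_mem (H.mul_mem hg ht) (H.inv_mem hg), ?_⟩
  rw [Units.val_mul, Units.val_mul, htv, mul_unitaryTransvection hσ hgu, mul_assoc,
    Units.mul_inv, mul_one]

/-- The vector `e_i + a e_j`. -/
def pairVec (i j : ι) (a : F) : ι → F :=
  Pi.single i 1 + Pi.single j a

lemma dotProduct_pairVec_sq {i j : ι} (hij : i ≠ j) (a : F) (w : ι → F) :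
    w ⬝ᵥ pairVec i j a ^ 2 = w i + w j * a ^ 2 := by
  have h : pairVec i j a ^ 2 = Pi.single i 1 + Pi.single j (a ^ 2) := by
    ext k
    by_cases hi : k = i
    · subst hi
      simp [pairVec, hij]
    · by_cases hj : k = j
      · subst hj
        simp [pairVec, hi]
      · simp [pairVec, hi, hj]
  rw [h, dotProduct_add, dotProduct_single, dotProduct_single, mul_one]

lemma unitaryTransvection_pairVec_mulVec (h2 : (2 : F) = 0) {i j : ι} (hij : i ≠ j) {a : F}
    (ha : a ^ 3 = 1) (w : ι → F) :
    unitaryTransvection (pairVec i j a) *ᵥ w =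
      Function.update (Function.update w i (a ^ 2 * w j)) j (a * w i) := by
  rw [unitaryTransvection_mulVec, dotProduct_pairVec_sq hij]
  ext k
  by_cases hj : k = j
  · subst hj
    simp [pairVec, hij.symm]
    linear_combination w k * ha + w k * h2
  · by_cases hi : k = i
    · subst hi
      simp [pairVec, hij]
      linear_combination w k * h2
    · simp [pairVec, hi, hj]

/-- A subgroup of `GL ι F` whose set of transvection directions is stable under the
subgroup. -/
def ConjStable (H : Subgroup (GL ι F)) : Prop :=
  ∀ g ∈ H, ∀ v, HasTransvection H v → HasTransvection H ((g : Matrix ι ι F) *ᵥ v)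

variable {H : Subgroup (GL ι F)}

lemma HasTransvection.transvect (hH : ConjStable H) {u v : ι → F} (hu : HasTransvection H u)
    (hv : HasTransvection H v) : HasTransvection H (v + (v ⬝ᵥ u ^ 2) • u) := by
  obtain ⟨t, ht, htu⟩ := hu
  rw [← unitaryTransvection_mulVec, ← htu]
  exact hH t ht v hv

lemma HasTransvection.smul {v : ι → F} (hv : HasTransvection H v) {c : F} (hc : c ^ 3 = 1) :
    HasTransvection H (c • v) := by
  obtain ⟨t, ht, htv⟩ := hv
  refine ⟨t, ht, htv.trans ?_⟩
  ext i j
  simp only [unitaryTransvection, Matrix.add_apply, vecMulVec_apply, Pi.pow_apply,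
    Pi.smul_apply, smul_eq_mul]
  linear_combination -(v i * v j ^ 2) * hc

lemma HasTransvection.pairVec_symm {i j : ι} {a : F} (ha : a ^ 3 = 1)
    (h : HasTransvection H (pairVec i j a)) : HasTransvection H (pairVec j i (a ^ 2)) := by
  have h' := h.smul (c := a ^ 2) (by linear_combination (a ^ 3 + 1) * ha)
  rwa [show a ^ 2 • pairVec i j a = pairVec j i (a ^ 2) by
    rw [pairVec, smul_add, ← Pi.single_smul, ← Pi.single_smul, smul_eq_mul, smul_eq_mul,
      mul_one, ← pow_succ, ha, add_comm, pairVec]] at h'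

lemma HasTransvection.pairVec_trans (hH : ConjStable H) (h2 : (2 : F) = 0) {i j k : ι}
    (hij : i ≠ j) (hik : i ≠ k) (hjk : j ≠ k) {a b : F} (hb : b ^ 3 = 1)
    (h : HasTransvection H (pairVec i j a)) (h' : HasTransvection H (pairVec j k b)) :
    HasTransvection H (pairVec i k (a * b)) := by
  have := h'.transvect hH h
  rw [← unitaryTransvection_mulVec, unitaryTransvection_pairVec_mulVec h2 hjk hb] at this
  convert this using 1
  ext l
  by_cases hk : l = k
  · subst hk
    simp [pairVec, hik.symm, hij.symm, mul_comm]
  · by_cases hj : l = j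
    · subst hj
      simp [pairVec, hk, hij.symm, hik.symm, hjk.symm]
    · by_cases hi : l = i
      · subst hi
        simp [pairVec, hij, hik]
      · simp [pairVec, hk, hj, hi]

lemma exists_mulVec_swap (h2 : (2 : F) = 0)
    (hp : ∀ i j, i ≠ j → ∀ a : F, a ^ 3 = 1 → HasTransvection H (pairVec i j a))
    {i j : ι} (hij : i ≠ j) {a : F} (ha : a ^ 3 = 1) :
    ∃ h ∈ H, ∀ w, (h : Matrix ι ι F) *ᵥ w =
      Function.update (Function.update w i (a ^ 2 * w j)) j (a * w i) := by
  obtain ⟨h, hh, e⟩ := hp i j hij a ha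
  exact ⟨h, hh, fun w ↦ by rw [e, unitaryTransvection_pairVec_mulVec h2 hij ha]⟩

lemma exists_mulVec_diagonal (h2 : (2 : F) = 0)
    (hp : ∀ i j, i ≠ j → ∀ a : F, a ^ 3 = 1 → HasTransvection H (pairVec i j a))
    {i j : ι} (hij : i ≠ j) {a : F} (ha : a ^ 3 = 1) :
    ∃ h ∈ H, ∀ w, (h : Matrix ι ι F) *ᵥ w =
      Function.update (Function.update w i (a * w i)) j (a ^ 2 * w j) := by
  obtain ⟨s, hs, es⟩ := exists_mulVec_swap h2 hp hij (one_pow 3)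
  obtain ⟨t, ht, et⟩ := exists_mulVec_swap h2 hp hij (a := a ^ 2)
    (by linear_combination (a ^ 3 + 1) * ha)
  refine ⟨t * s, H.mul_mem ht hs, fun w ↦ ?_⟩
  rw [Units.val_mul, ← mulVec_mulVec, es, et]
  ext k
  by_cases hj : k = j
  · subst hj
    simp [hij]
  · by_cases hi : k = i
    · subst hi
      simp only [ne_eq, hij, not_false_eq_true, Function.update_of_ne, Function.update_self]
      linear_combination a * w k * ha
    · simp [hi, hj]

lemma HasTransvection.comp_perm (hH : ConjStable H) (h2 : (2 : F) = 0)
    (hp : ∀ i j, i ≠ j → ∀ a : F, a ^ 3 = 1 → HasTransvection H (pairVec i j a))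
    {v : ι → F} (hv : HasTransvection H v) (π : Equiv.Perm ι) : HasTransvection H (v ∘ π) := by
  induction π using Equiv.Perm.swap_induction_on' with
  | one => exact hv
  | mul_swap f x y hxy ih =>
    obtain ⟨h, hh, e⟩ := exists_mulVec_swap h2 hp hxy (one_pow 3)
    have := hH h hh _ ih
    rw [e] at this
    convert this using 1
    ext k
    by_cases hy : k = y
    · subst hy
      simp
    · by_cases hx : k = x
      · subst hx
        simp [hxy]
      · simp [hx, hy, Equiv.swap_apply_of_ne_of_ne hx hy]

lemma HasTransvection.of_support_eq (hH : ConjStable H) (h2 : (2 : F) = 0)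
    (h3 : ∀ a : F, a ≠ 0 → a ^ 3 = 1)
    (hp : ∀ i j, i ≠ j → ∀ a : F, a ^ 3 = 1 → HasTransvection H (pairVec i j a))
    {v v' : ι → F} (hv : HasTransvection H v) (hs : ∀ i, v i = 0 ↔ v' i = 0) {z : ι}
    (hz : v z = 0) : HasTransvection H v' := by
  have key (s : Finset ι) : HasTransvection H (fun i ↦ if i ∈ s then v' i else v i) := by
    induction s using Finset.induction_on with
    | empty => simpa using hv
    | insert a s ha ih =>
      by_cases h0 : v a = 0
      · convert ih using 1
        ext i
        by_cases hi : i = a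
        · subst hi
          simp [h0, (hs i).1 h0]
        · simp [hi]
      · have haz : a ≠ z := fun h ↦ h0 (h ▸ hz)
        obtain ⟨h, hh, e⟩ := exists_mulVec_diagonal h2 hp haz
          (h3 (v' a / v a) (div_ne_zero (fun h ↦ h0 ((hs a).2 h)) h0))
        have := hH h hh _ ih
        rw [e] at this
        convert this using 1
        ext i
        by_cases hi : i = z
        · subst hi
          simp [hz, (hs i).1 hz]
        · by_cases hi' : i = a
          · subst hi'
            simp [haz, ha, h0]
          · simp [hi, hi']
  simpa using key Finset.univ

variable [DecidableEq F]

lemma HasTransvection.of_card_support_eq (hH : ConjStable H) (h2 : (2 : F) = 0)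
    (h3 : ∀ a : F, a ≠ 0 → a ^ 3 = 1)
    (hp : ∀ i j, i ≠ j → ∀ a : F, a ^ 3 = 1 → HasTransvection H (pairVec i j a))
    {v v' : ι → F} (hv : HasTransvection H v)
    (hs : Fintype.card {i // v' i ≠ 0} = Fintype.card {i // v i ≠ 0}) {z : ι}
    (hz : v' z = 0) : HasTransvection H v' := by
  let e := Fintype.equivOfCardEq hs
  have hsupp (i : ι) : (v ∘ e.extendSubtype) i = 0 ↔ v' i = 0 := by
    by_cases hi : v' i = 0
    · simpa [hi] using e.extendSubtype_not_mem i (by simpa using hi)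
    · simpa [hi] using e.extendSubtype_mem i hi
  exact (hv.comp_perm hH h2 hp e.extendSubtype).of_support_eq hH h2 h3 hp hsupp
    ((hsupp z).2 hz)

/-- A vector with at least three nonzero coordinates can be moved by an element of `H` to one
with two of these coordinates killed, using only the three coordinates. -/
lemma exists_kill_two (h2 : (2 : F) = 0) (h3 : ∀ a : F, a ≠ 0 → a ^ 3 = 1)
    (hp : ∀ i j, i ≠ j → ∀ a : F, a ^ 3 = 1 → HasTransvection H (pairVec i j a))
    (h4 : ∀ v : ι → F, Fintype.card {i // v i ≠ 0} = 4 → HasTransvection H v)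
    (hcard : 4 ≤ Fintype.card ι) {ω : F} (hω : ω ^ 2 + ω + 1 = 0) {i j l : ι} (hij : i ≠ j)
    (hil : i ≠ l) (hjl : j ≠ l) {v : ι → F} (hi : v i ≠ 0) (hj : v j ≠ 0) (hl : v l ≠ 0) :
    ∃ h ∈ H, (∀ w : ι → F, w i = 0 → w j = 0 → w l = 0 → (h : Matrix ι ι F) *ᵥ w = w) ∧
      (h : Matrix ι ι F) *ᵥ v = Function.update (Function.update v j 0) l 0 := by
  obtain ⟨m, hm⟩ : ∃ m, m ∉ ({i, j, l} : Finset ι) := by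
    by_contra! h
    have := Finset.card_le_card (s := Finset.univ) fun x _ ↦ h x
    have := Finset.card_le_three (a := i) (b := j) (c := l)
    rw [Finset.card_univ] at *
    omega
  simp only [Finset.mem_insert, Finset.mem_singleton, not_or] at hm
  obtain ⟨hmi, hmj, hml⟩ : m ≠ i ∧ m ≠ j ∧ m ≠ l := hm
  have hω3 : ω ^ 3 = 1 := by linear_combination (ω - 1) * hω
  have hω0 : ω ≠ 0 := by
    rintro rfl
    simp at hω3
  let p (d : F) : ι → F := fun k ↦
    if k = i then v i else if k = j then ω ^ 2 * v j else if k = l then ω ^ 2 * v l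
    else if k = m then d else 0
  have hpi (d : F) : p d i = v i := by simp [p]
  have hpj (d : F) : p d j = ω ^ 2 * v j := by simp [p, hij.symm]
  have hpl (d : F) : p d l = ω ^ 2 * v l := by simp [p, hil.symm, hjl.symm]
  have hpm (d : F) : p d m = d := by simp [p, hmi, hmj, hml]
  have hpd (d : F) (k : ι) (h : k ≠ m) : p d k = p 0 k := by simp [p, h]
  have hp0 (d : F) (k : ι) (h1 : k ≠ i) (h2 : k ≠ j) (h3 : k ≠ l) (h4 : k ≠ m) : p d k = 0 := by
    simp [p, h1, h2, h3, h4]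
  have hpT (d : F) (hd : d ≠ 0) : HasTransvection H (p d) := by
    apply h4
    rw [Fintype.card_subtype, show Finset.univ.filter (fun k ↦ p d k ≠ 0) = {i, j, l, m} by
      ext k
      simp only [p, Finset.mem_filter, Finset.mem_univ, true_and, Finset.mem_insert,
        Finset.mem_singleton]
      split_ifs <;> simp_all]
    simp [hij, hil, hjl, hmi.symm, hmj.symm, hml.symm]
  have hdot (w : ι → F) (d : F) : w ⬝ᵥ p d ^ 2 =
      w i * v i ^ 2 + w j * (ω ^ 2 * v j) ^ 2 + w l * (ω ^ 2 * v l) ^ 2 + w m * d ^ 2 := by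
    rw [dotProduct, ← Finset.sum_subset (Finset.subset_univ ({i, j, l, m} : Finset ι))]
    · rw [Finset.sum_insert, Finset.sum_insert, Finset.sum_insert, Finset.sum_singleton]
      · simp only [Pi.pow_apply, hpi, hpj, hpl, hpm]
        ring
      all_goals simp [hij, hil, hjl, hmi.symm, hmj.symm, hml.symm]
    · intro k _ hk
      simp only [Finset.mem_insert, Finset.mem_singleton, not_or] at hk
      simp [hp0 d k hk.1 hk.2.1 hk.2.2.1 hk.2.2.2]
  obtain ⟨s, hs, es⟩ := hpT 1 one_ne_zero
  obtain ⟨t, ht, et⟩ := hpT ω hω0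
  obtain ⟨r, hr, er⟩ := exists_mulVec_diagonal h2 hp hmi.symm hω3
  have hact (w : ι → F) : ((r * (t * s) : GL ι F) : Matrix ι ι F) *ᵥ w = fun k ↦
      if k = i then ω * (w i + ω * (w i * v i ^ 2 + w j * (ω ^ 2 * v j) ^ 2 +
        w l * (ω ^ 2 * v l) ^ 2) * v i) else
      if k = m then w m else
      w k + ω * (w i * v i ^ 2 + w j * (ω ^ 2 * v j) ^ 2 + w l * (ω ^ 2 * v l) ^ 2) * p 0 k := by
    rw [Units.val_mul, Units.val_mul, ← mulVec_mulVec, ← mulVec_mulVec, es, et, er]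
    rw [unitaryTransvection_mulVec, unitaryTransvection_mulVec, hdot, hdot]
    have hvi := h3 _ hi
    have hvj := h3 _ hj
    have hvl := h3 _ hl
    set S := w i * v i ^ 2 + w j * (ω ^ 2 * v j) ^ 2 + w l * (ω ^ 2 * v l) ^ 2 with hS
    set W := w + (S + w m * 1 ^ 2) • p 1 with hW
    have hd : W i * v i ^ 2 + W j * (ω ^ 2 * v j) ^ 2 + W l * (ω ^ 2 * v l) ^ 2 + W m * ω ^ 2 =
        w m + ω ^ 2 * S := by
      simp only [hW, Pi.add_apply, Pi.smul_apply, smul_eq_mul, hpi, hpj, hpl, hpm]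
      linear_combination (S + w m) * (hvi + ω ^ 6 * hvj + ω ^ 6 * hvl) +
        2 * (S + w m) * (ω ^ 3 + 1) * hω3 - hS + 2 * w m * hω - w m * (ω + 1) * h2 +
        (2 * S + w m) * h2
    rw [hd]
    ext k
    by_cases hkm : k = m
    · subst hkm
      simp only [Function.update_self, if_neg hmi, if_true, hW, Pi.add_apply, Pi.smul_apply,
        smul_eq_mul, hpm]
      linear_combination (w k + ω ^ 2 * S) * hω3 + ω ^ 2 * (w k + S) * h2
    · by_cases hki : k = i
      · subst hki
        simp only [Function.update_self, Function.update_of_ne hkm, if_true, hW, Pi.add_apply,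
          Pi.smul_apply, smul_eq_mul, hpi]
        linear_combination ω * v k * (S * hω + (w m - ω * S) * h2)
      · simp only [Function.update_of_ne hkm, Function.update_of_ne hki, if_neg hkm, if_neg hki,
          hW, Pi.add_apply, Pi.smul_apply, smul_eq_mul, hpd _ k hkm]
        linear_combination p 0 k * (S * hω + (w m - ω * S) * h2)
  refine ⟨r * (t * s), H.mul_mem hr (H.mul_mem ht hs), fun w hwi hwj hwl ↦ ?_, ?_⟩
  · rw [hact]
    ext k
    simp only [hwi, hwj, hwl]
    split_ifs with h h <;> simp_all
  · have hsum : v i * v i ^ 2 + v j * (ω ^ 2 * v j) ^ 2 + v l * (ω ^ 2 * v l) ^ 2 = 1 := by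
      linear_combination h3 _ hi + ω ^ 4 * h3 _ hj + ω ^ 4 * h3 _ hl + 2 * ω * hω3 + ω * h2
    rw [hact, hsum]
    ext k
    by_cases h : k = l
    · subst h
      simp [hil.symm, hml.symm, hpl]
      linear_combination v k * hω3 + v k * h2
    by_cases h' : k = j
    · subst h'
      simp [hij.symm, hmj.symm, hpj, h]
      linear_combination v k * hω3 + v k * h2
    by_cases h'' : k = i
    · subst h''
      simp [h, h']
      linear_combination v k * hω - v k * h2
    simp only [h'', h, h', if_false, ne_eq, not_false_eq_true, Function.update_of_ne]
    split_ifs with hkm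
    · rw [hkm]
    · simp [hp0 0 k h'' h' h hkm]

/-- `H` acts transitively on the vectors with an odd number of nonzero coordinates outside `s`,
through elements fixing the coordinate vectors indexed by `s`. -/
lemma exists_mulVec_eq_single (h2 : (2 : F) = 0) (h3 : ∀ a : F, a ≠ 0 → a ^ 3 = 1)
    (hp : ∀ i j, i ≠ j → ∀ a : F, a ^ 3 = 1 → HasTransvection H (pairVec i j a))
    (h4 : ∀ v : ι → F, Fintype.card {i // v i ≠ 0} = 4 → HasTransvection H v)
    (hcard : 4 ≤ Fintype.card ι) {ω : F} (hω : ω ^ 2 + ω + 1 = 0) {s : Finset ι} {t t' : ι}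
    (ht : t ∉ s) (ht' : t' ∉ s) (htt : t ≠ t') (v : ι → F) (hv : ∀ i ∈ s, v i = 0)
    (hodd : Odd (Finset.univ.filter (fun i ↦ v i ≠ 0)).card) :
    ∃ h ∈ H, (∀ w : ι → F, (∀ i ∉ s, w i = 0) → (h : Matrix ι ι F) *ᵥ w = w) ∧
      (h : Matrix ι ι F) *ᵥ v = Pi.single t 1 := by
  induction hn : (Finset.univ.filter (fun i ↦ v i ≠ 0)).card using Nat.strong_induction_on
    generalizing v with
  | _ n ih =>
  subst hn
  rcases Nat.lt_or_ge 2 (Finset.univ.filter (fun i ↦ v i ≠ 0)).card with hlt | hle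
  · obtain ⟨i, j, l, hi, hj, hl, hij, hil, hjl⟩ := Finset.two_lt_card_iff.1 hlt
    simp only [Finset.mem_filter, Finset.mem_univ, true_and] at hi hj hl
    obtain ⟨h, hh, hfix, hhv⟩ := exists_kill_two h2 h3 hp h4 hcard hω hij hil hjl hi hj hl
    have hsupp : Finset.univ.filter
        (fun k ↦ Function.update (Function.update v j 0) l 0 k ≠ 0) =
        ((Finset.univ.filter (fun i ↦ v i ≠ 0)).erase j).erase l := by
      ext k
      by_cases hkl : k = l
      · subst hkl
        simp
      · by_cases hkj : k = j
        · subst hkj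
          simp [hkl]
        · simp [hkl, hkj]
    have hc : (Finset.univ.filter
        (fun k ↦ Function.update (Function.update v j 0) l 0 k ≠ 0)).card + 2 =
        (Finset.univ.filter (fun i ↦ v i ≠ 0)).card := by
      rw [hsupp, Finset.card_erase_of_mem (by simp [hjl.symm, hl]),
        Finset.card_erase_of_mem (by simp [hj])]
      omega
    obtain ⟨g, hg, hgfix, hgv⟩ := ih _ (by omega)
      (Function.update (Function.update v j 0) l 0) (fun k hk ↦ by
        by_cases hkl : k = l
        · simp [hkl]
        · by_cases hkj : k = j <;> simp [hkl, hkj, hv k hk, hjl])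
      (by rw [← hc] at hodd; exact (Nat.odd_add.1 hodd).2 even_two) rfl
    have hns {k : ι} (hk : v k ≠ 0) : k ∉ s := fun h ↦ hk (hv k h)
    refine ⟨g * h, H.mul_mem hg hh, fun w hw ↦ ?_, ?_⟩
    · rw [Units.val_mul, ← mulVec_mulVec,
        hfix w (hw _ (hns hi)) (hw _ (hns hj)) (hw _ (hns hl)), hgfix w hw]
    · rw [Units.val_mul, ← mulVec_mulVec, hhv, hgv]
  · have h1 : (Finset.univ.filter (fun i ↦ v i ≠ 0)).card = 1 := by
      obtain ⟨k, hk⟩ := hodd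
      omega
    obtain ⟨i, hi⟩ := Finset.card_eq_one.1 h1
    have hsupp (k : ι) : v k ≠ 0 ↔ k = i := by
      simpa using congrArg (k ∈ ·) hi
    have hvi : v i ≠ 0 := (hsupp i).2 rfl
    have hv0 (k : ι) (hk : k ≠ i) : v k = 0 := not_not.1 (mt (hsupp k).1 hk)
    have hinv : (v i)⁻¹ ^ 3 = 1 := h3 _ (inv_ne_zero hvi)
    have his : i ∉ s := fun h ↦ hvi (hv i h)
    have hupd (w : ι → F) {a b : ι} (ha : w a = 0) (hb : w b = 0) :
        Function.update (Function.update w a 0) b 0 = w := by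
      rw [(Function.update_eq_self_iff (f := w) (a := a)).2 ha.symm,
        Function.update_eq_self_iff.2 hb.symm]
    by_cases hit : i = t
    · subst hit
      obtain ⟨h, hh, e⟩ := exists_mulVec_diagonal h2 hp htt hinv
      refine ⟨h, hh, fun w hw ↦ ?_, ?_⟩
      · rw [e, hw i ht, hw t' ht', mul_zero, mul_zero,
          hupd w (hw i ht) (hw t' ht')]
      · rw [e, inv_mul_cancel₀ hvi, hv0 t' htt.symm, mul_zero]
        ext k
        by_cases hkt : k = t'
        · subst hkt
          simp [htt.symm]
        · by_cases hki : k = i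
          · subst hki
            simp [htt]
          · simp [hkt, hki, hv0 k hki]
    · obtain ⟨h, hh, e⟩ := exists_mulVec_swap h2 hp hit hinv
      refine ⟨h, hh, fun w hw ↦ ?_, ?_⟩
      · rw [e, hw i his, hw t ht, mul_zero, mul_zero, hupd w (hw i his) (hw t ht)]
      · rw [e, inv_mul_cancel₀ hvi, hv0 t (Ne.symm hit), mul_zero]
        ext k
        by_cases hkt : k = t
        · subst hkt
          simp
        · by_cases hki : k = i
          · subst hki
            simp [hit]
          · simp [hkt, hki, hv0 k hki]

end Transvections

lemma odd_card_support {ι F : Type*} [Fintype ι] [Field F] [DecidableEq F]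
    (h2 : (2 : F) = 0) (h3 : ∀ a : F, a ≠ 0 → a ^ 3 = 1) {v : ι → F} (hv : ∑ i, v i ^ 3 = 1) :
    Odd (Finset.univ.filter (fun i ↦ v i ≠ 0)).card := by
  have h : ((Finset.univ.filter (fun i ↦ v i ≠ 0)).card : F) = 1 := by
    rw [← hv, Finset.card_filter, Nat.cast_sum]
    refine Finset.sum_congr rfl fun i _ ↦ ?_
    by_cases hi : v i = 0
    · simp [hi]
    · simp [hi, h3 _ hi]
  by_contra hodd
  obtain ⟨k, hk⟩ := Nat.not_odd_iff_even.1 hodd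
  rw [hk, Nat.cast_add] at h
  exact one_ne_zero (by linear_combination -h + (k : F) * h2 : (1 : F) = 0)

lemma mem_of_unitary_of_det_eq_one {F : Type*} [Field F] [DecidableEq F] {n : ℕ} (hn : 4 ≤ n)
    {H : Subgroup (GL (Fin n) F)} {σ : F →+* F} (hσ : ∀ a, σ a = a ^ 2)
    (h2 : (2 : F) = 0) (h3 : ∀ a : F, a ≠ 0 → a ^ 3 = 1)
    (hp : ∀ i j, i ≠ j → ∀ a : F, a ^ 3 = 1 → HasTransvection H (pairVec i j a))
    (h4 : ∀ v : Fin n → F, Fintype.card {i // v i ≠ 0} = 4 → HasTransvection H v)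
    {ω : F} (hω : ω ^ 2 + ω + 1 = 0)
    (hH : ∀ g ∈ H, (g : Matrix (Fin n) (Fin n) F).det = 1 ∧
      (g : Matrix (Fin n) (Fin n) F)ᵀ * (g : Matrix (Fin n) (Fin n) F).map σ = 1)
    (g : GL (Fin n) F) (hdet : (g : Matrix (Fin n) (Fin n) F).det = 1)
    (hg : (g : Matrix (Fin n) (Fin n) F)ᵀ * (g : Matrix (Fin n) (Fin n) F).map σ = 1) :
    g ∈ H := by
  have key (k : ℕ) : ∀ g : GL (Fin n) F, (g : Matrix (Fin n) (Fin n) F).det = 1 →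
      (g : Matrix (Fin n) (Fin n) F)ᵀ * (g : Matrix (Fin n) (Fin n) F).map σ = 1 →
      (∀ m : Fin n, k ≤ m → (g : Matrix (Fin n) (Fin n) F) *ᵥ Pi.single m 1 = Pi.single m 1) →
      g ∈ H := by
    induction k with
    | zero =>
      intro g _ _ hfix
      have : g = 1 := by
        ext i j
        have := congrFun (hfix j (Nat.zero_le _)) i
        rw [mulVec_single_one] at this
        simpa [Matrix.one_apply, Pi.single_apply] using this
      exact this ▸ H.one_mem
    | succ k ih =>
      intro g hdet hg hfix
      by_cases hkn : n ≤ k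
      · exact ih g hdet hg fun m hm ↦ absurd m.isLt (by omega)
      push Not at hkn
      let t : Fin n := ⟨k, hkn⟩
      have hcol (m : Fin n) (hm : k + 1 ≤ m) (i : Fin n) :
          (g : Matrix (Fin n) (Fin n) F) i m = if i = m then 1 else 0 := by
        have := congrFun (hfix m hm) i
        rw [mulVec_single_one] at this
        simpa [Pi.single_apply] using this
      have hzero (m : Fin n) (hm : k + 1 ≤ m) : (g : Matrix (Fin n) (Fin n) F) m t = 0 := by
        have := congrFun (congrFun hg t) m
        rw [Matrix.mul_apply] at this
        have htm : t ≠ m := by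
          rintro rfl
          simp [t] at hm
        simpa [hcol m hm, apply_ite σ, htm] using this
      rcases Nat.eq_zero_or_pos k with rfl | hk
      · have hdiag : (g : Matrix (Fin n) (Fin n) F) =
            diagonal (Function.update 1 t ((g : Matrix (Fin n) (Fin n) F) t t)) := by
          ext i j
          by_cases hj : j = t
          · subst hj
            by_cases hi : i = t
            · subst hi
              simp
            · rw [hzero i (by have : (i : ℕ) ≠ 0 := fun h ↦ hi (Fin.ext h); omega),
                diagonal_apply_ne _ hi]
          · rw [hcol j (by have : (j : ℕ) ≠ 0 := fun h ↦ hj (Fin.ext h); omega),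
              diagonal_apply]
            split_ifs with hij
            · subst hij
              simp [hj]
            · rfl
        have hone : (g : Matrix (Fin n) (Fin n) F) t t = 1 := by
          rw [hdiag, det_diagonal, Finset.prod_update_of_mem (Finset.mem_univ t)] at hdet
          simpa using hdet
        have : g = 1 := by
          ext i j
          rw [hdiag, hone]
          simp
        exact this ▸ H.one_mem
      · let s : Finset (Fin n) := Finset.univ.filter (fun m ↦ k + 1 ≤ m)
        obtain ⟨h, hh, hhfix, hht⟩ := exists_mulVec_eq_single h2 h3 hp h4 (by simpa using hn) hω
          (s := s) (t := t) (t' := ⟨0, by omega⟩) (by simp [s, t]) (by simp [s])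
          (by simp only [t, ne_eq, Fin.mk.injEq]; omega)
          (fun i ↦ (g : Matrix (Fin n) (Fin n) F) i t)
          (fun i hi ↦ hzero i (by simpa [s] using hi))
          (odd_card_support h2 h3 (by
            have := congrFun (congrFun hg t) t
            rw [Matrix.mul_apply] at this
            simp only [transpose_apply, map_apply, hσ, one_apply_eq] at this
            rw [← this]
            exact Finset.sum_congr rfl fun i _ ↦ pow_succ' _ _))
        have hmem : h * g ∈ H := by
          refine ih (h * g) ?_ ?_ fun m hm ↦ ?_
          · rw [Units.val_mul, det_mul, (hH h hh).1, hdet, one_mul]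
          · rw [Units.val_mul, transpose_mul, Matrix.map_mul, mul_assoc,
              ← mul_assoc (h : Matrix (Fin n) (Fin n) F)ᵀ, (hH h hh).2, one_mul, hg]
          · rw [Units.val_mul, ← mulVec_mulVec]
            by_cases hmt : m = t
            · subst hmt
              rw [mulVec_single_one]
              exact hht
            · have hm' : k + 1 ≤ m := by
                have : (m : ℕ) ≠ k := fun h ↦ hmt (Fin.ext h)
                omega
              rw [hfix m hm']
              refine hhfix _ fun i hi ↦ ?_
              rw [Pi.single_eq_of_ne]
              rintro rfl
              exact hi (by simpa [s] using hm')
        exact (H.mul_mem_cancel_left hh).1 hmem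
  exact key n g hdet hg fun m hm ↦ absurd m.isLt (by omega)

/-- A computable model of the field with four elements. -/
abbrev Quad := QuadraticAlgebra (ZMod 2) 1 1

/-- The element of multiplicative order three of `Quad` playing the role of `ω`. -/
def quadOmega : Quad := ⟨0, 1⟩

/-- The generator `x` over the computable model. -/
def quadX : Matrix (Fin 7) (Fin 7) Quad :=
  let a := quadOmega
  !![0,1,0,0,0,0,0; 1,0,0,0,0,0,0; 0,0,1,0,0,0,0; 0,0,0,1,1,0,a;
    0,0,0,1,0,a^2,a; 0,0,0,0,a,1,a^2; 0,0,0,a^2,a^2,a,0]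

/-- The generator `y` over the computable model. -/
def quadY : Matrix (Fin 7) (Fin 7) Quad :=
  !![1,0,0,0,0,0,0; 0,0,0,1,0,0,0; 0,1,0,0,0,0,0; 0,0,1,0,0,0,0;
    0,0,0,0,0,0,1; 0,0,0,0,1,0,0; 0,0,0,0,0,1,0]

/-- The initial direction of a transvection. -/
def quadV : Fin 7 → Quad := ![0, 1, quadOmega, 1, 0, quadOmega, 0]

lemma quad_word_pow_nine :
    (quadX * quadY * quadY * (quadX * quadY) * (quadX * quadY)) ^ 9 =
      1 + vecMulVec quadV (quadV ^ 2) := by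
  let a := quadOmega
  let b := quadOmega ^ 2
  have h1 : quadX * quadY = !![0, 0, 0, 1, 0, 0, 0; 1, 0, 0, 0, 0, 0, 0; 0, 1, 0, 0, 0, 0, 0;
      0, 0, 1, 0, 0, a, 1; 0, 0, 1, 0, b, a, 0; 0, 0, 0, 0, 1, b, a; 0, 0, b, 0, a, 0, b] := by
    decide +kernel
  have h2 : quadX * quadY * quadY * (quadX * quadY) * (quadX * quadY) =
      !![1, 0, 0, 0, 0, 0, 0; 0, 0, 1, 0, 0, a, 1; 0, 1, b, 0, 0, 1, 0; 0, a, 1, 1, b, 0, 1;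
        0, 0, 1, 1, 0, a, 0; 0, 0, a, 0, 1, b, 0; 0, 1, 0, b, a, 1, b] := by
    rw [h1]
    decide +kernel
  have h3 : (quadX * quadY * quadY * (quadX * quadY) * (quadX * quadY)) ^ 3 =
      !![1, 0, 0, 0, 0, 0, 0; 0, a, 1, 1, a, 0, 1; 0, 0, a, a, 0, a, 0; 0, 1, b, 0, 1, b, b;
        0, a, 0, b, 1, b, 1; 0, b, 0, a, 1, a, b; 0, b, 0, 1, b, 1, 1] := by
    rw [h2]
    decide +kernel
  rw [show 9 = 3 * 3 from rfl, pow_mul, h3]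
  decide +kernel

lemma exists_ringHom_quad {F : Type*} [Field F] (h2 : (2 : F) = 0) {ω : F}
    (hω : ω ^ 2 + ω + 1 = 0) : ∃ φ : Quad →+* F, φ quadOmega = ω := by
  have : CharP F 2 := CharTwo.of_one_ne_zero_of_two_eq_zero one_ne_zero h2
  let _ := ZMod.algebra F 2
  have h : ω * ω = (1 : ZMod 2) • (1 : F) + (1 : ZMod 2) • ω := by
    rw [one_smul, one_smul]
    linear_combination hω - (ω + 1) * h2
  refine ⟨(QuadraticAlgebra.lift (R := ZMod 2) ⟨ω, h⟩).toRingHom, ?_⟩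
  simp [quadOmega, QuadraticAlgebra.lift]

section Generators

variable {F : Type*} [Field F] {H : Subgroup (GL (Fin 7) F)} {X Y : GL (Fin 7) F}
  {φ : Quad →+* F}

lemma HasTransvection.of_quad_mulVec (hH : ConjStable H) {A : Matrix (Fin 7) (Fin 7) Quad}
    {g : GL (Fin 7) F} (hg : g ∈ H) (hA : (g : Matrix (Fin 7) (Fin 7) F) = A.map φ)
    {v : Fin 7 → Quad} (hv : HasTransvection H (φ ∘ v)) (u : Fin 7 → Quad) (hu : A *ᵥ v = u) :
    HasTransvection H (φ ∘ u) := by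
  have := hH g hg _ hv
  rw [hA] at this
  convert this using 1
  ext i
  rw [← RingHom.map_mulVec, hu, Function.comp_apply]

lemma HasTransvection.of_quad_transvect (hH : ConjStable H) {u v : Fin 7 → Quad}
    (hu : HasTransvection H (φ ∘ u)) (hv : HasTransvection H (φ ∘ v)) (w : Fin 7 → Quad)
    (hw : v + (v ⬝ᵥ u ^ 2) • u = w) : HasTransvection H (φ ∘ w) := by
  convert hu.transvect hH hv using 1
  subst hw
  ext i
  simp [dotProduct]

lemma hasTransvection_quadV (hX : X ∈ H) (hXm : (X : Matrix (Fin 7) (Fin 7) F) = quadX.map φ)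
    (hY : Y ∈ H) (hYm : (Y : Matrix (Fin 7) (Fin 7) F) = quadY.map φ) :
    HasTransvection H (φ ∘ quadV) := by
  have hXY := H.mul_mem hX hY
  refine ⟨(X * Y * Y * (X * Y) * (X * Y)) ^ 9,
    H.pow_mem (H.mul_mem (H.mul_mem (H.mul_mem hXY hY) hXY) hXY) 9, ?_⟩
  have := congrArg φ.mapMatrix quad_word_pow_nine
  simp only [map_pow, map_mul, map_add, map_one, RingHom.mapMatrix_apply] at this
  rw [← hXm, ← hYm] at this
  simp only [Units.val_pow_eq_pow_val, Units.val_mul, this, unitaryTransvection]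
  congr 1
  ext i j
  simp [vecMulVec_apply]

/-- A subgroup containing the generators contains the transvections with directions
`e₀ + e₅`, `e₀ + e₁` and `e₀ + ω e₁`. -/
lemma hasTransvection_pairVec_of_quad (hH : ConjStable H) (hX : X ∈ H)
    (hXm : (X : Matrix (Fin 7) (Fin 7) F) = quadX.map φ)
    (hY : Y ∈ H) (hYm : (Y : Matrix (Fin 7) (Fin 7) F) = quadY.map φ) :
    HasTransvection H (pairVec 0 5 1 : Fin 7 → F) ∧
      HasTransvection H (pairVec 0 1 1 : Fin 7 → F) ∧
      HasTransvection H (pairVec 0 1 (φ quadOmega) : Fin 7 → F) := by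
  let a := quadOmega
  let b := quadOmega ^ 2
  have v0 := hasTransvection_quadV hX hXm hY hYm
  have v1 := v0.of_quad_mulVec hH hX hXm ![1, 0, a, 1, 0, a, 0] (by decide +kernel)
  have w1 := v1.of_quad_mulVec hH hY hYm ![1, 1, 0, a, 0, 0, a] (by decide +kernel)
  have v2 := w1.of_quad_mulVec hH hY hYm ![1, a, 1, 0, a, 0, 0] (by decide +kernel)
  have v3 := v2.of_quad_mulVec hH hX hXm ![a, 1, 1, a, 0, b, 1] (by decide +kernel)
  have v4 := v3.of_quad_mulVec hH hY hYm ![a, a, 1, 1, 1, 0, b] (by decide +kernel)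
  have v5 := v4.of_quad_mulVec hH hX hXm ![a, a, 1, 1, 0, 0, 0] (by decide +kernel)
  have v6 := v5.of_quad_mulVec hH hY hYm ![a, 1, a, 1, 0, 0, 0] (by decide +kernel)
  have v7 := v0.of_quad_transvect hH v6 ![a, 0, 0, 0, 0, a, 0] (by decide +kernel)
  have v8 := v1.of_quad_transvect hH v0 ![1, 1, 0, 0, 0, 0, 0] (by decide +kernel)
  have v9 := v0.of_quad_mulVec hH hY hYm ![0, 1, 1, a, 0, 0, a] (by decide +kernel)
  have v10 := v1.of_quad_transvect hH v9 ![1, 1, b, b, 0, a, a] (by decide +kernel)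
  have v11 := v3.of_quad_transvect hH v10 ![a, b, 1, 0, 0, b, 0] (by decide +kernel)
  have v12 := v5.of_quad_transvect hH v11 ![1, 0, b, a, 0, b, 0] (by decide +kernel)
  have v13 := v0.of_quad_transvect hH v12 ![1, a, 0, 0, 0, 0, 0] (by decide +kernel)
  have hω3 : φ quadOmega ^ 3 = 1 := by
    rw [← map_pow, show quadOmega ^ 3 = 1 by decide +kernel, map_one]
  refine ⟨?_, ?_, ?_⟩
  · convert v7.smul (c := φ quadOmega ^ 2)
      (by linear_combination (φ quadOmega ^ 3 + 1) * hω3) using 1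
    ext i
    fin_cases i <;> simp [pairVec, a, ← pow_succ, hω3]
  · convert v8 using 1
    ext i
    fin_cases i <;> simp [pairVec]
  · convert v13 using 1
    ext i
    fin_cases i <;> simp [pairVec, a]

lemma hasTransvection_pairVec (hH : ConjStable H) (h2 : (2 : F) = 0)
    (hω : φ quadOmega ^ 2 + φ quadOmega + 1 = 0) (hX : X ∈ H)
    (hXm : (X : Matrix (Fin 7) (Fin 7) F) = quadX.map φ)
    (hY : Y ∈ H) (hYm : (Y : Matrix (Fin 7) (Fin 7) F) = quadY.map φ) (i j : Fin 7)
    (hij : i ≠ j) (a : F) (ha : a ^ 3 = 1) : HasTransvection H (pairVec i j a) := by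
  obtain ⟨h05, h01, h01'⟩ := hasTransvection_pairVec_of_quad hH hX hXm hY hYm
  have h10 : HasTransvection H (pairVec 1 0 1 : Fin 7 → F) := by
    simpa using h01.pairVec_symm (one_pow 3)
  have hω3 : φ quadOmega ^ 3 = 1 := by linear_combination (φ quadOmega - 1) * hω
  have hrot (j k : Fin 7) (hjk : quadY *ᵥ Pi.single j 1 = Pi.single k 1) (a : F)
      (h : HasTransvection H (pairVec 0 j a)) : HasTransvection H (pairVec 0 k a) := by
    have hcol (j k : Fin 7) (hjk : quadY *ᵥ Pi.single j 1 = Pi.single k 1) (a : F) :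
        (Y : Matrix (Fin 7) (Fin 7) F) *ᵥ Pi.single j a = Pi.single k a := by
      ext i
      have := congrFun hjk i
      rw [mulVec_single_one] at this
      rw [hYm, mulVec_single]
      simp only [col_apply] at this
      by_cases hik : i = k
      · subst hik
        simp [this]
      · simp [this, hik]
    have := hH Y hY _ h
    rwa [pairVec, mulVec_add, hcol j k hjk, hcol 0 0 (by decide +kernel)] at this
  have h12 : HasTransvection H (pairVec 1 2 (φ quadOmega) : Fin 7 → F) := by
    simpa using h10.pairVec_trans hH h2 (by decide) (by decide) (by decide) hω3
      (hrot 1 2 (by decide +kernel) _ h01')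
  have h02 := h01'.pairVec_trans hH h2 (by decide) (by decide) (by decide) hω3 h12
  have hb1 (a : F) (ha : a ^ 3 = 1) : HasTransvection H (pairVec 0 1 a) := by
    have : (a - 1) * ((a - φ quadOmega) * (a - φ quadOmega * φ quadOmega)) = 0 := by
      linear_combination ha - (a - 1) * a * hω + (a - 1) * hω3
    rcases mul_eq_zero.1 this with h | h
    · rwa [sub_eq_zero.1 h]
    · rcases mul_eq_zero.1 h with h | h
      · rwa [sub_eq_zero.1 h]
      · rw [sub_eq_zero.1 h]
        exact hrot 3 1 (by decide +kernel) _ (hrot 2 3 (by decide +kernel) _ h02)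
  have h15 : HasTransvection H (pairVec 1 5 1 : Fin 7 → F) := by
    simpa using h10.pairVec_trans hH h2 (by decide) (by decide) (by decide) (one_pow 3) h05
  have hb5 (a : F) (ha : a ^ 3 = 1) : HasTransvection H (pairVec 0 5 a) := by
    simpa using (hb1 a ha).pairVec_trans hH h2 (by decide) (by decide) (by decide)
      (one_pow 3) h15
  have hb (j : Fin 7) (hj : j ≠ 0) (a : F) (ha : a ^ 3 = 1) :
      HasTransvection H (pairVec 0 j a) := by
    have hb2 := hrot 1 2 (by decide +kernel) a (hb1 a ha)
    have hb6 := hrot 5 6 (by decide +kernel) a (hb5 a ha)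
    fin_cases j
    · exact absurd rfl hj
    · exact hb1 a ha
    · exact hb2
    · exact hrot 2 3 (by decide +kernel) a hb2
    · exact hrot 6 4 (by decide +kernel) a hb6
    · exact hb5 a ha
    · exact hb6
  by_cases hi : i = 0
  · subst hi
    exact hb j hij.symm a ha
  by_cases hj : j = 0
  · subst hj
    have := (hb i hi (a ^ 2) (by linear_combination (a ^ 3 + 1) * ha)).pairVec_symm
      (by linear_combination (a ^ 3 + 1) * ha)
    rwa [show (a ^ 2) ^ 2 = a by linear_combination a * ha] at this
  · have h := (hb i hi 1 (one_pow 3)).pairVec_symm (one_pow 3)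
    simpa using h.pairVec_trans hH h2 hi hij (Ne.symm hj) ha (hb j hj a ha)

end Generators

/-- The matrices of determinant one which are unitary with respect to the standard form twisted
by `σ`. -/
def specialUnitary {ι F : Type*} [Fintype ι] [DecidableEq ι] [Field F] (σ : F →+* F) :
    Subgroup (GL ι F) where
  carrier := {g | (g : Matrix ι ι F).det = 1 ∧
    (g : Matrix ι ι F)ᵀ * (g : Matrix ι ι F).map σ = 1}
  one_mem' := by simp
  mul_mem' := by
    rintro a b ⟨had, hau⟩ ⟨hbd, hbu⟩
    refine ⟨by rw [Units.val_mul, det_mul, had, hbd, one_mul], ?_⟩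
    rw [Units.val_mul, transpose_mul, Matrix.map_mul, mul_assoc,
      ← mul_assoc (a : Matrix ι ι F)ᵀ, hau, one_mul, hbu]
  inv_mem' := by
    rintro g ⟨hd, hu⟩
    have hmul : (g : Matrix ι ι F) * ((g⁻¹ : GL ι F) : Matrix ι ι F) = 1 := Units.mul_inv g
    have hinv : ((g⁻¹ : GL ι F) : Matrix ι ι F).map σ = (g : Matrix ι ι F)ᵀ := by
      have h : (g : Matrix ι ι F).map σ * ((g⁻¹ : GL ι F) : Matrix ι ι F).map σ = 1 := by
        rw [← Matrix.map_mul, hmul, Matrix.map_one _ (map_zero σ) (map_one σ)]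
      rw [← one_mul (((g⁻¹ : GL ι F) : Matrix ι ι F).map σ), ← hu, mul_assoc, h, mul_one]
    refine ⟨by rw [← one_mul (det _), ← hd, ← det_mul, hmul, det_one, hd], ?_⟩
    rw [hinv, ← transpose_mul, hmul, transpose_one]

lemma transpose_mul_map_quad {F : Type*} [Field F] {σ : F →+* F} (hσ : ∀ a, σ a = a ^ 2)
    (φ : Quad →+* F) {A : Matrix (Fin 7) (Fin 7) Quad} (hA : Aᵀ * A.map (· ^ 2) = 1) :
    (A.map φ)ᵀ * (A.map φ).map σ = 1 := by
  have : (A.map φ).map σ = (A.map (· ^ 2)).map φ := by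
    ext i j
    simp [hσ]
  rw [this, ← transpose_map, ← Matrix.map_mul, hA, Matrix.map_one _ (map_zero φ) (map_one φ)]

/-- **`SU_7(4)` is `(2,3)`-generated, by explicit generators.** Let `F` be the field with
`4` elements, `ω ∈ F` with `ω² + ω + 1 = 0` and `σ : α ↦ α²` the Frobenius automorphism.
Then the explicit matrices `x` and `y` satisfy `x² = y³ = 1`, are unitary of determinant
one, and generate `SU_7(4)`: an invertible matrix `g` satisfies `det g = 1` and
`gᵀ g^σ = 1` if and only if it lies in the subgroup generated by `x` and `y`. In
particular `SU_7(4)` is `(2,3)`-generated. -/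
theorem SU7_of_4_eq_closure_of_generators (F : Type) [Field F] [Fintype F]
    (hF : Fintype.card F = 4) (ω : F) (hω : ω ^ 2 + ω + 1 = 0)
    (σ : F →+* F) (hσ : ∀ α : F, σ α = α ^ 2)
    (x y : Matrix (Fin 7) (Fin 7) F)
    (hx : x = !![0,1,0,0,0,0,0; 1,0,0,0,0,0,0; 0,0,1,0,0,0,0; 0,0,0,1,1,0,ω;
      0,0,0,1,0,ω^2,ω; 0,0,0,0,ω,1,ω^2; 0,0,0,ω^2,ω^2,ω,0])
    (hy : y = !![1,0,0,0,0,0,0; 0,0,0,1,0,0,0; 0,1,0,0,0,0,0; 0,0,1,0,0,0,0;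
      0,0,0,0,0,0,1; 0,0,0,0,1,0,0; 0,0,0,0,0,1,0]) :
    x ^ 2 = 1 ∧ y ^ 3 = 1 ∧
    xᵀ * x.map σ = 1 ∧ yᵀ * y.map σ = 1 ∧ x.det = 1 ∧ y.det = 1 ∧
    ∃ X Y : GL (Fin 7) F, (X : Matrix (Fin 7) (Fin 7) F) = x ∧
      (Y : Matrix (Fin 7) (Fin 7) F) = y ∧ orderOf X = 2 ∧ orderOf Y = 3 ∧
      ∀ g : GL (Fin 7) F,
        ((g : Matrix (Fin 7) (Fin 7) F).det = 1 ∧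
            (g : Matrix (Fin 7) (Fin 7) F)ᵀ * (g : Matrix (Fin 7) (Fin 7) F).map σ = 1) ↔
          g ∈ Subgroup.closure {X, Y} := by
  have h2 : (2 : F) = 0 := by
    have h := hσ (1 + 1)
    rw [map_add, map_one] at h
    linear_combination -h
  have h3 (a : F) (ha : a ≠ 0) : a ^ 3 = 1 := by
    simpa [hF] using FiniteField.pow_card_sub_one_eq_one a ha
  obtain ⟨φ, hφ⟩ := exists_ringHom_quad h2 hω
  have hxm : x = quadX.map φ := by
    rw [hx]
    ext i j
    fin_cases i <;> fin_cases j <;> simp [quadX, hφ]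
  have hym : y = quadY.map φ := by
    rw [hy]
    ext i j
    fin_cases i <;> fin_cases j <;> simp [quadY]
  have hx2 : x ^ 2 = 1 := by
    rw [hxm, ← RingHom.mapMatrix_apply, ← map_pow,
      show quadX ^ 2 = 1 by decide +kernel, map_one]
  have hy3 : y ^ 3 = 1 := by
    rw [hym, ← RingHom.mapMatrix_apply, ← map_pow,
      show quadY ^ 3 = 1 by decide +kernel, map_one]
  have hxu : xᵀ * x.map σ = 1 := hxm ▸ transpose_mul_map_quad hσ φ (by decide +kernel)
  have hyu : yᵀ * y.map σ = 1 := hym ▸ transpose_mul_map_quad hσ φ (by decide +kernel)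
  have hxd : x.det = 1 := by
    have h : x.det ^ 2 = 1 := by rw [← det_pow, hx2, det_one]
    have : (x.det - 1) ^ 2 = 0 := by linear_combination h + (1 - x.det) * h2
    exact sub_eq_zero.1 (pow_eq_zero_iff two_ne_zero |>.1 this)
  have hyd : y.det = 1 := by
    have hσy : y.map σ = y := by
      rw [hym]
      ext i j
      fin_cases i <;> fin_cases j <;> simp [quadY]
    have h : y.det ^ 2 = 1 := by
      have := congrArg det hyu
      rwa [hσy, det_mul, det_transpose, det_one, ← sq] at this
    have : (y.det - 1) ^ 2 = 0 := by linear_combination h + (1 - y.det) * h2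
    exact sub_eq_zero.1 (pow_eq_zero_iff two_ne_zero |>.1 this)
  let X : GL (Fin 7) F := ⟨x, x, by rw [← sq, hx2], by rw [← sq, hx2]⟩
  let Y : GL (Fin 7) F := ⟨y, y ^ 2, by rw [← pow_succ', hy3], by rw [← pow_succ, hy3]⟩
  refine ⟨hx2, hy3, hxu, hyu, hxd, hyd, X, Y, rfl, rfl, ?_, ?_, fun g ↦ ?_⟩
  · refine orderOf_eq_prime (Units.ext (by rw [Units.val_pow_eq_pow_val]; exact hx2))
      fun h ↦ ?_
    have := congrArg (fun g : GL (Fin 7) F ↦ (g : Matrix (Fin 7) (Fin 7) F) 0 0) h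
    simp [X, hx] at this
  · refine orderOf_eq_prime (Units.ext (by rw [Units.val_pow_eq_pow_val]; exact hy3))
      fun h ↦ ?_
    have := congrArg (fun g : GL (Fin 7) F ↦ (g : Matrix (Fin 7) (Fin 7) F) 1 1) h
    simp [Y, hy] at this
  classical
  set H := Subgroup.closure {X, Y} with hHdef
  have hX : X ∈ H := Subgroup.subset_closure (by simp)
  have hY : Y ∈ H := Subgroup.subset_closure (by simp)
  have hle : H ≤ specialUnitary σ := by
    rw [hHdef, Subgroup.closure_le]
    rintro _ (rfl | rfl)
    exacts [⟨hxd, hxu⟩, ⟨hyd, hyu⟩]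
  have hH : ConjStable H := fun g hg v hv ↦ hv.mulVec hσ hg (hle hg).2
  have hp := hasTransvection_pairVec hH h2 (by rwa [hφ]) hX hxm hY hym
  have hV : Fintype.card {i // (φ ∘ quadV) i ≠ 0} = 4 := by
    have hω0 : ω ≠ 0 := by
      rintro rfl
      simp at hω
    rw [Fintype.card_subtype, show Finset.univ.filter (fun i ↦ (φ ∘ quadV) i ≠ 0) =
      {1, 2, 3, 5} by
        ext i
        rw [Finset.mem_filter]
        fin_cases i <;> simp [quadV, hφ, hω0]]
    rfl
  have h4 (v : Fin 7 → F) (hv : Fintype.card {i // v i ≠ 0} = 4) : HasTransvection H v := by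
    obtain ⟨z, hz⟩ : ∃ z, v z = 0 := by
      by_contra! h
      rw [Fintype.card_subtype, Finset.filter_true_of_mem fun i _ ↦ h i] at hv
      simp at hv
    exact (hasTransvection_quadV hX hxm hY hym).of_card_support_eq hH h2 h3 hp
      (hv.trans hV.symm) hz
  exact ⟨fun h ↦ mem_of_unitary_of_det_eq_one (by norm_num) hσ h2 h3 hp h4 hω
    (fun g hg ↦ hle hg) g h.1 h.2, fun h ↦ hle h⟩
end

section
/- Let F be a field of characteristic different from 2 and a ∈ F with a ≠ 2, set b = a, and let x, y be the 7×7 matrices of the dimension-7 setup. Then for all units α, β ∈ Fˣ, the characteristic polynomial of x·y, which equals t⁷ − t⁵ − (a−1)t⁴ + (a−1)t³ + t² − 1, is different from (t−1)(t−α)(t−β)(t−αβ)(t−α⁻¹)(t−β⁻¹)(t−(αβ)⁻¹); equivalently, x·y is not conjugate to the diagonal matrix diag(1, α, β, αβ, α⁻¹, β⁻¹, (αβ)⁻¹) for any α, β. (This is the key computational step showing that ⟨x,y⟩ is not contained in a subgroup isomorphic to G₂(q), whose maximal tori consist of such diagonal elements.) -/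
open Matrix Polynomial

/-- The product of the two generators of the dimension-7 setup with `b = a`. -/
lemma dim7_generators_mul {R : Type*} [CommRing R] (a : R) :
    !![0,1,0,0,0,0,a; 1,0,0,0,0,0,a; 0,0,0,1,0,0,0; 0,0,1,0,0,0,0;
      0,0,0,0,0,1,-1; 0,0,0,0,1,0,-1; 0,0,0,0,0,0,-1] *
    !![1,0,-1,0,-1,0,a+a-1; 0,0,-1,0,0,0,0; 0,1,-1,0,0,0,0; 0,0,0,0,-1,0,0;
      0,0,0,1,-1,0,0; 0,0,0,0,0,0,-1; 0,0,0,0,0,1,-1] =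
    !![0,0,-1,0,0,a,-a; 1,0,-1,0,-1,a,a-1; 0,0,0,0,-1,0,0; 0,1,-1,0,0,0,0;
      0,0,0,0,0,-1,0; 0,0,0,1,-1,-1,1; 0,0,0,0,0,-1,1] := by
  ext i j
  fin_cases i <;> fin_cases j <;> simp [Matrix.mul_apply, Fin.sum_univ_succ]
  ring

lemma dim7_generators_mul_charpoly {R : Type*} [CommRing R] (a : R) :
    !![0,0,-1,0,0,a,-a; 1,0,-1,0,-1,a,a-1; 0,0,0,0,-1,0,0; 0,1,-1,0,0,0,0;
      0,0,0,0,0,-1,0; 0,0,0,1,-1,-1,1; 0,0,0,0,0,-1,1].charpoly =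
    X ^ 7 - X ^ 5 - C (a - 1) * X ^ 4 + C (a - 1) * X ^ 3 + X ^ 2 - 1 := by
  have h : charmatrix !![0,0,-1,0,0,a,-a; 1,0,-1,0,-1,a,a-1; 0,0,0,0,-1,0,0; 0,1,-1,0,0,0,0;
      0,0,0,0,0,-1,0; 0,0,0,1,-1,-1,1; 0,0,0,0,0,-1,1] =
      !![X,0,1,0,0,-C a,C a; -1,X,1,0,1,-C a,1-C a; 0,0,X,0,1,0,0; 0,-1,1,X,0,0,0;
      0,0,0,0,X,1,0; 0,0,0,-1,1,X+1,-1; 0,0,0,0,0,1,X-1] := by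
    ext1 i j
    fin_cases i <;> fin_cases j <;> simp
  rw [Matrix.charpoly, h]
  have s₁ : Fin.succAbove (1 : Fin 7) = ![0, 2, 3, 4, 5, 6] := by decide
  have s₂ : Fin.succAbove (2 : Fin 6) = ![0, 1, 3, 4, 5] := by decide
  have s₃ : Fin.succAbove (2 : Fin 5) = ![0, 1, 3, 4] := by decide
  have s₄ : Fin.succAbove (1 : Fin 5) = ![0, 2, 3, 4] := by decide
  have s₅ : Fin.succAbove (1 : Fin 4) = ![0, 2, 3] := by decide
  have s₆ : Fin.succAbove (2 : Fin 4) = ![0, 1, 3] := by decide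
  rw [det_succ_column_zero (n := 6)]
  simp [Fin.sum_univ_succ]
  simp only [det_succ_column_zero (n := 5)]
  simp [Fin.sum_univ_succ]
  simp only [det_succ_column_zero (n := 4)]
  simp [Fin.sum_univ_succ, s₁, s₂, s₃, s₄]
  simp only [det_succ_column_zero (n := 3)]
  simp [Fin.sum_univ_succ, s₅, s₆]
  simp [det_fin_three]
  ring

/-- The third elementary symmetric function of the weights of the 7-dimensional module of
`G₂` is determined by the first two, since `Λ³V ≅ V ⊕ S²V`. -/
lemma G2_torus_prod_eq {R : Type*} [CommRing R] (p q u v : R) (hp : p * u = 1)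
    (hq : q * v = 1) :
    ∃ e₁ e₂ : R, (X - 1) * (X - C p) * (X - C q) * (X - C (p * q)) * (X - C u) *
        (X - C v) * (X - C (u * v)) =
      X ^ 7 - C e₁ * X ^ 6 + C e₂ * X ^ 5 - C (e₁ + e₁ ^ 2 - e₂) * X ^ 4
        + C (e₁ + e₁ ^ 2 - e₂) * X ^ 3 - C e₂ * X ^ 2 + C e₁ * X - 1 := by
  -- `A`, `B`, `D` are the traces on the three pairs of opposite weights
  set A := p + u with hA
  set B := q + v with hB
  set D := p * q + u * v with hD
  have h₁ : (X - C p) * (X - C u) = X ^ 2 - C A * X + 1 := by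
    rw [hA, ← C_1, ← hp]; simp only [C_add, C_mul]; ring
  have h₂ : (X - C q) * (X - C v) = X ^ 2 - C B * X + 1 := by
    rw [hB, ← C_1, ← hq]; simp only [C_add, C_mul]; ring
  have hpq : p * q * (u * v) = 1 := by linear_combination q * v * hp + hq
  have h₃ : (X - C (p * q)) * (X - C (u * v)) = X ^ 2 - C D * X + 1 := by
    rw [hD, ← C_1, ← hpq]; simp only [C_add, C_mul]; ring
  have hABD : A ^ 2 + B ^ 2 + D ^ 2 = A * B * D + 4 := by
    rw [hA, hB, hD]
    linear_combination (2 - q ^ 2 - v ^ 2) * hp + (2 - p ^ 2 - u ^ 2) * hq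
  refine ⟨1 + A + B + D, 3 + A + B + D + A * B + A * D + B * D, ?_⟩
  have h := congrArg (C : R → R[X]) hABD
  simp only [C_add, C_mul, C_pow, map_ofNat] at h
  calc
    _ = (X - 1) * ((X - C p) * (X - C u)) * ((X - C q) * (X - C v)) *
        ((X - C (p * q)) * (X - C (u * v))) := by ring
    _ = _ := by
      rw [h₁, h₂, h₃]
      simp only [C_add, C_mul, C_pow, C_sub, C_1, map_ofNat]
      linear_combination (X ^ 4 - X ^ 3) * h

lemma coeff_antipalindromic_seven {R : Type*} [CommRing R] (c₁ c₂ c₃ : R) (n : ℕ) :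
    (X ^ 7 - C c₁ * X ^ 6 + C c₂ * X ^ 5 - C c₃ * X ^ 4 + C c₃ * X ^ 3 - C c₂ * X ^ 2
      + C c₁ * X - 1).coeff n =
    (if n = 7 then 1 else 0) - (if n = 6 then c₁ else 0) + (if n = 5 then c₂ else 0)
      - (if n = 4 then c₃ else 0) + (if n = 3 then c₃ else 0) - (if n = 2 then c₂ else 0)
      + (if n = 1 then c₁ else 0) - (if n = 0 then 1 else 0) := by
  simp only [coeff_sub, coeff_add, coeff_C_mul, coeff_X_pow, coeff_X, coeff_one, mul_ite,
    mul_one, mul_zero, eq_comm (a := 1) (b := n)]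

/-- **`x·y` avoids the `G₂`-tori, dimension 7.** Let `F` be a field of characteristic
different from `2` and `a ∈ F` with `a ≠ 2`, with `b = a`, and let `x, y` be the matrices
of the dimension-7 setup. The characteristic polynomial of `x·y` equals
`t⁷ − t⁵ − (a−1)t⁴ + (a−1)t³ + t² − 1` and, for all units `α, β`, it is different from
`(t−1)(t−α)(t−β)(t−αβ)(t−α⁻¹)(t−β⁻¹)(t−(αβ)⁻¹)`. -/
theorem dim7_charpoly_ne_G2_torus_charpoly (F : Type) [Field F]
    (hchar : ringChar F ≠ 2) (a : F) (ha : a ≠ 2)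
    (x y : Matrix (Fin 7) (Fin 7) F)
    (hx : x = !![0,1,0,0,0,0,a; 1,0,0,0,0,0,a; 0,0,0,1,0,0,0; 0,0,1,0,0,0,0;
      0,0,0,0,0,1,-1; 0,0,0,0,1,0,-1; 0,0,0,0,0,0,-1])
    (hy : y = !![1,0,-1,0,-1,0,a+a-1; 0,0,-1,0,0,0,0; 0,1,-1,0,0,0,0; 0,0,0,0,-1,0,0;
      0,0,0,1,-1,0,0; 0,0,0,0,0,0,-1; 0,0,0,0,0,1,-1]) :
    (x * y).charpoly
        = X ^ 7 - X ^ 5 - C (a - 1) * X ^ 4 + C (a - 1) * X ^ 3 + X ^ 2 - 1 ∧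
      ∀ α β : Fˣ, (x * y).charpoly ≠
        (X - 1) * (X - C (α : F)) * (X - C (β : F)) * (X - C ((α : F) * (β : F))) *
          (X - C ((α⁻¹ : Fˣ) : F)) * (X - C ((β⁻¹ : Fˣ) : F)) *
          (X - C (((α * β)⁻¹ : Fˣ) : F)) := by
  have hxy : (x * y).charpoly
      = X ^ 7 - X ^ 5 - C (a - 1) * X ^ 4 + C (a - 1) * X ^ 3 + X ^ 2 - 1 := by
    rw [hx, hy, dim7_generators_mul, dim7_generators_mul_charpoly]
  refine ⟨hxy, fun α β h => ha ?_⟩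
  obtain ⟨e₁, e₂, he⟩ := G2_torus_prod_eq (α : F) β ((α⁻¹ : Fˣ) : F) ((β⁻¹ : Fˣ) : F)
    α.mul_inv β.mul_inv
  rw [mul_inv, Units.val_mul, hxy, he] at h
  have h' : X ^ 7 - X ^ 5 - C (a - 1) * X ^ 4 + C (a - 1) * X ^ 3 + X ^ 2 - 1 =
      X ^ 7 - C (0 : F) * X ^ 6 + C (-1) * X ^ 5 - C (a - 1) * X ^ 4 + C (a - 1) * X ^ 3
        - C (-1) * X ^ 2 + C 0 * X - 1 := by
    simp only [C_0, C_neg, C_1]; ring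
  rw [h'] at h
  have hn (n : ℕ) := congrArg (coeff · n) h
  simp only [coeff_antipalindromic_seven] at hn
  have h₆ : e₁ = 0 := by simpa using hn 6
  have h₅ : -1 = e₂ := by simpa using hn 5
  have h₄ : 1 - a = e₂ - (e₁ + e₁ ^ 2) := by simpa using hn 4
  rw [h₆, ← h₅] at h₄
  linear_combination -h₄
end
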